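/- Let m ≥ 1, let μ be a probability distribution on F_2^m, and for each power of two n = 2^k let X be an m×n random matrix with i.i.d. columns distributed according to μ, and Y = X·G_n over F_2. Fix α < 1/2 and set ε_n = 2^{−n^α}. For j ∈ {1,…,n}, let r_j denote the maximal rank of a binary matrix A (with m columns) such that H(A·Y_j | Y_1,…,Y_{j-1}) ≤ ε_n. Then (1/n)·Σ_{j=1}^n (m − r_j) converges to H(μ) as k → ∞. -/

import Mathlib

open MeasureTheory ProbabilityTheory Filter
open scoped Classical

/-- Shannon entropy (in bits) of a finite-valued random variable `X` on `(Ω, μ)`: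
`H(X) = ∑ₓ P(X = x) log₂ (1 / P(X = x))`. -/
noncomputable def shEnt {Ω : Type*} [MeasurableSpace Ω] (μ : Measure Ω)
    {α : Type*} [Fintype α] (X : Ω → α) : ℝ :=
  (∑ x : α, Real.negMulLog ((μ (X ⁻¹' {x})).toReal)) / Real.log 2

/-- Conditional Shannon entropy (in bits) of discrete random variables:
`H(X | Y) = H(X, Y) - H(Y)`. -/
noncomputable def cEnt {Ω : Type*} [MeasurableSpace Ω] (μ : Measure Ω)
    {α β : Type*} [Fintype α] [Fintype β] (X : Ω → α) (Y : Ω → β) : ℝ :=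
  shEnt μ (fun ω => (X ω, Y ω)) - shEnt μ Y

/-- Shannon entropy (in bits) of a distribution on a finite set. -/
noncomputable def distEnt {α : Type*} [MeasurableSpace α] [Fintype α] (ν : Measure α) : ℝ :=
  (∑ x : α, Real.negMulLog ((ν {x}).toReal)) / Real.log 2

/-- The binary entropy function `h(p) = -p log₂ p - (1-p) log₂ (1-p)`. -/
noncomputable def binEnt (p : ℝ) : ℝ :=
  (Real.negMulLog p + Real.negMulLog (1 - p)) / Real.log 2

/-- The Bernoulli(p) distribution on `F₂` (probability `p` of the outcome `1`). -/
noncomputable def bern (p : ℝ) : Measure (ZMod 2) :=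
  ENNReal.ofReal (1 - p) • Measure.dirac 0 + ENNReal.ofReal p • Measure.dirac 1

/-- `G k` is the `2^k × 2^k` matrix over `F₂` given by the `k`-fold Kronecker power of
`[[1,0],[1,1]]`, in closed form: the `(i,j)` entry is `1` iff each binary digit of `j`
is dominated by the corresponding binary digit of `i` (for the single factor
`[[1,0],[1,1]]`, the `(a,b)` entry is `1` iff the bit `b` is dominated by the bit `a`,
and the Kronecker power multiplies these bitwise conditions). -/
def G (k : ℕ) : Matrix (Fin (2 ^ k)) (Fin (2 ^ k)) (ZMod 2) :=
  Matrix.of fun i j => if j.val &&& i.val = j.val then 1 else 0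

/-- The maximal rank of a binary matrix `A` with `m` columns (and any number of rows)
such that `H(A ⬝ Yj | past) ≤ ε`; this is `0` when only rank-zero maps qualify
(the zero matrix always qualifies). -/
noncomputable def maxRank {Ω : Type*} [MeasurableSpace Ω] (μ : Measure Ω) {m : ℕ}
    {β : Type*} [Fintype β] (Yj : Ω → Fin m → ZMod 2) (past : Ω → β) (ε : ℝ) : ℕ :=
  sSup {r : ℕ | ∃ (l : ℕ) (A : Matrix (Fin l) (Fin m) (ZMod 2)),
    A.rank = r ∧ cEnt μ (fun ω => A.mulVec (Yj ω)) past ≤ ε}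

/-! ### Averages over the leaves of a binary tree of states -/

/-- Average of `g` over the `2 ^ k` states reached by `k` applications of `σ` or `τ`. -/
noncomputable def treeAvg {S : Type*} (σ τ : S → S) : ℕ → (S → ℝ) → S → ℝ
  | 0, g => g
  | k + 1, g => fun s => (treeAvg σ τ k g (σ s) + treeAvg σ τ k g (τ s)) / 2

section TreeAvg

variable {S : Type*} {σ τ : S → S}

lemma treeAvg_comm (k : ℕ) (g : S → ℝ) (s : S) : treeAvg σ τ k g s = treeAvg τ σ k g s := by
  induction k generalizing s with
  | zero => rfl
  | succ k ih => simp only [treeAvg, ih]; ring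

lemma treeAvg_add_index (k l : ℕ) (g : S → ℝ) (s : S) :
    treeAvg σ τ (k + l) g s = treeAvg σ τ k (treeAvg σ τ l g) s := by
  induction k generalizing s with
  | zero => simp [treeAvg]
  | succ k ih => rw [Nat.succ_add]; simp only [treeAvg, ih]

lemma treeAvg_mono {g h : S → ℝ} (hgh : ∀ s, g s ≤ h s) (k : ℕ) (s : S) :
    treeAvg σ τ k g s ≤ treeAvg σ τ k h s := by
  induction k generalizing s with
  | zero => exact hgh s
  | succ k ih => simp only [treeAvg]; linarith [ih (σ s), ih (τ s)]

lemma treeAvg_const (c : ℝ) (k : ℕ) (s : S) : treeAvg σ τ k (fun _ => c) s = c := by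
  induction k generalizing s with
  | zero => rfl
  | succ k ih => simp only [treeAvg, ih]; ring

lemma treeAvg_add (g h : S → ℝ) (k : ℕ) (s : S) :
    treeAvg σ τ k (fun x => g x + h x) s = treeAvg σ τ k g s + treeAvg σ τ k h s := by
  induction k generalizing s with
  | zero => rfl
  | succ k ih => simp only [treeAvg, ih]; ring

lemma treeAvg_const_mul (c : ℝ) (g : S → ℝ) (k : ℕ) (s : S) :
    treeAvg σ τ k (fun x => c * g x) s = c * treeAvg σ τ k g s := by
  induction k generalizing s with
  | zero => rfl
  | succ k ih => simp only [treeAvg, ih]; ring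

lemma treeAvg_sum {ι : Type*} (I : Finset ι) (g : ι → S → ℝ) (k : ℕ) (s : S) :
    treeAvg σ τ k (fun x => ∑ i ∈ I, g i x) s = ∑ i ∈ I, treeAvg σ τ k (g i) s := by
  induction k generalizing s with
  | zero => rfl
  | succ k ih => simp only [treeAvg, ih, ← Finset.sum_add_distrib, Finset.sum_div]

lemma treeAvg_eq_of_step {g : S → ℝ} (hg : ∀ s, (g (σ s) + g (τ s)) / 2 = g s) (k : ℕ) (s : S) :
    treeAvg σ τ k g s = g s := by
  induction k generalizing s with
  | zero => rfl
  | succ k ih => simp only [treeAvg, ih, hg]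

/-- If `f` at least squares along `σ` and grows at most by the factor `C` along `τ`, it rarely
leaves a small neighbourhood of `0`, and inside it decays geometrically. -/
lemma treeAvg_exceed_le_geometric {f : S → ℝ} {C δ r q θ : ℝ} (hf : ∀ s, 0 ≤ f s)
    (hσ : ∀ s, f (σ s) ≤ f s ^ 2) (hτ : ∀ s, f (τ s) ≤ C * f s) (hC : 0 ≤ C) (hδ : 0 < δ)
    (hr : 0 < r) (hq : (C ^ r + δ ^ r) / 2 ≤ q) (hq1 : q ≤ 1) (hθ : 0 < θ) (k : ℕ) (s : S) :
    treeAvg σ τ k (fun x => if θ < f x then 1 else 0) s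
      ≤ (f s / δ) ^ r + q ^ k * (f s / θ) ^ r := by
  have hq0 : 0 ≤ q := le_trans (by positivity) hq
  induction k generalizing s with
  | zero =>
    have h0 : 0 ≤ (f s / δ) ^ r := Real.rpow_nonneg (div_nonneg (hf s) hδ.le) _
    have h1 : 0 ≤ (f s / θ) ^ r := Real.rpow_nonneg (div_nonneg (hf s) hθ.le) _
    simp only [treeAvg, pow_zero, one_mul]
    split_ifs with h
    · have : (1 : ℝ) ≤ (f s / θ) ^ r :=
        Real.one_le_rpow ((one_le_div hθ).2 h.le) hr.le
      linarith
    · linarith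
  | succ k ih =>
    by_cases h : f s ≤ δ
    · have hs := hf s
      have e1 : f (σ s) ^ r ≤ δ ^ r * f s ^ r := by
        rw [← Real.mul_rpow hδ.le hs]
        refine Real.rpow_le_rpow (hf _) ((hσ s).trans ?_) hr.le
        nlinarith
      have e2 : f (τ s) ^ r ≤ C ^ r * f s ^ r := by
        rw [← Real.mul_rpow hC hs]
        exact Real.rpow_le_rpow (hf _) (hτ s) hr.le
      have hfr : 0 ≤ f s ^ r := Real.rpow_nonneg hs _
      have i1 := ih (σ s)
      have i2 := ih (τ s)
      simp only [treeAvg]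
      rw [Real.div_rpow (hf _) hδ.le, Real.div_rpow (hf _) hθ.le] at i1 i2 ⊢
      have hδr : 0 < δ ^ r := Real.rpow_pos_of_pos hδ _
      have hθr : 0 < θ ^ r := Real.rpow_pos_of_pos hθ _
      have key : (f (σ s) ^ r + f (τ s) ^ r) / 2 ≤ q * f s ^ r := by nlinarith
      have hc : 0 ≤ 1 / δ ^ r + q ^ k / θ ^ r := by positivity
      calc _ ≤ ((f (σ s) ^ r + f (τ s) ^ r) / 2) * (1 / δ ^ r + q ^ k / θ ^ r) := by
            refine (div_le_div_of_nonneg_right (add_le_add i1 i2) (by norm_num)).trans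
              (le_of_eq ?_)
            ring
        _ ≤ (q * f s ^ r) * (1 / δ ^ r + q ^ k / θ ^ r) :=
            mul_le_mul_of_nonneg_right key hc
        _ = q * (f s ^ r / δ ^ r) + q ^ (k + 1) * (f s ^ r / θ ^ r) := by ring
        _ ≤ _ := by
            have : q * (f s ^ r / δ ^ r) ≤ 1 * (f s ^ r / δ ^ r) :=
              mul_le_mul_of_nonneg_right hq1 (by positivity)
            linarith
    · have h1 : treeAvg σ τ (k + 1) (fun x => if θ < f x then (1 : ℝ) else 0) s ≤ 1 := by
        refine (treeAvg_mono (h := fun _ => 1) (fun x => ?_) _ _).trans (treeAvg_const 1 _ _).le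
        split_ifs <;> norm_num
      have h2 : (1 : ℝ) ≤ (f s / δ) ^ r :=
        Real.one_le_rpow ((one_le_div hδ).2 (not_le.1 h).le) hr.le
      have h3 : 0 ≤ q ^ (k + 1) * (f s / θ) ^ r :=
        mul_nonneg (pow_nonneg hq0 _) (Real.rpow_nonneg (div_nonneg (hf s) hθ.le) _)
      linarith

/-- Once `f` is so small that the growth along `τ` is negligible, its exponent doubles with
every application of `σ`. -/
lemma treeAvg_exceed_le_doubling {f : S → ℝ} {C r t : ℝ} (hf : ∀ s, 0 ≤ f s)
    (hσ : ∀ s, f (σ s) ≤ f s ^ 2) (hτ : ∀ s, f (τ s) ≤ C * f s) (hC : 1 ≤ C)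
    (hr : 0 < r) (ht : 0 < t) (k : ℕ) (u : ℝ) (hu : 0 < u) (s : S)
    (hs : C ^ k * f s ≤ 2 ^ (-u)) :
    treeAvg σ τ k (fun x => if (2 : ℝ) ^ (-t) < f x then 1 else 0) s
      ≤ (t / u) ^ r * ((1 + 2 ^ (-r)) / 2) ^ k := by
  have hC0 : 0 ≤ C := by linarith
  induction k generalizing s u with
  | zero =>
    simp only [treeAvg, pow_zero, mul_one, one_mul] at hs ⊢
    split_ifs with h
    · have h1 : (2 : ℝ) ^ (-t) < 2 ^ (-u) := h.trans_le hs
      have h2 : u < t := by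
        have := (Real.rpow_lt_rpow_left_iff (by norm_num : (1 : ℝ) < 2)).1 h1
        linarith
      exact Real.one_le_rpow ((one_le_div hu).2 h2.le) hr.le
    · positivity
  | succ k ih =>
    have hfs := hf s
    have hCk : 1 ≤ C ^ k := one_le_pow₀ hC
    have hCk1 : 1 ≤ C ^ (k + 1) := one_le_pow₀ hC
    have a1 : C ^ k * f (σ s) ≤ 2 ^ (-(2 * u)) := by
      have e : (2 : ℝ) ^ (-(2 * u)) = (2 ^ (-u)) ^ 2 := by
        rw [← Real.rpow_natCast, ← Real.rpow_mul (by norm_num)]; congr 1; push_cast; ring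
      rw [e]
      calc C ^ k * f (σ s) ≤ C ^ k * f s ^ 2 := mul_le_mul_of_nonneg_left (hσ s) (by positivity)
        _ ≤ (C ^ (k + 1)) ^ 2 * f s ^ 2 := by
            refine mul_le_mul_of_nonneg_right ?_ (by positivity)
            rw [← pow_mul]
            exact pow_le_pow_right₀ hC (by omega)
        _ = (C ^ (k + 1) * f s) ^ 2 := by ring
        _ ≤ _ := pow_le_pow_left₀ (by positivity) hs 2
    have a2 : C ^ k * f (τ s) ≤ 2 ^ (-u) := by
      refine le_trans ?_ hs
      calc C ^ k * f (τ s) ≤ C ^ k * (C * f s) := mul_le_mul_of_nonneg_left (hτ s) (by positivity)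
        _ = _ := by ring
    have i1 := ih (2 * u) (by positivity) (σ s) a1
    have i2 := ih u hu (τ s) a2
    have e : (t / (2 * u)) ^ r = (t / u) ^ r * 2 ^ (-r) := by
      rw [Real.rpow_neg (by norm_num), ← div_eq_mul_inv, ← Real.div_rpow (by positivity)
        (by norm_num)]
      congr 1
      field_simp
    rw [e] at i1
    simp only [treeAvg]
    calc _ ≤ _ := div_le_div_of_nonneg_right (add_le_add i1 i2) (by norm_num)
      _ = _ := by ring

lemma exists_rpow_mean_lt_one {b : ℝ} (hb : b < 1 / 2) :
    ∃ r : ℝ, 0 < r ∧ (2 : ℝ) ^ (b * r) * ((1 + 2 ^ (-r)) / 2) < 1 := by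
  have hd : HasDerivAt (fun r : ℝ => (2 : ℝ) ^ (b * r) * ((1 + 2 ^ (-r)) / 2))
      (Real.log 2 * (b - 1 / 2)) 0 := by
    have h1 : HasDerivAt (fun r : ℝ => (2 : ℝ) ^ (b * r)) (Real.log 2 * b) 0 := by
      have := ((hasDerivAt_id (0 : ℝ)).const_mul b).const_rpow (by norm_num : (0 : ℝ) < 2)
      simpa using this
    have h2 : HasDerivAt (fun r : ℝ => (2 : ℝ) ^ (-r)) (Real.log 2 * (-1)) 0 := by
      have := ((hasDerivAt_id (0 : ℝ)).neg).const_rpow (by norm_num : (0 : ℝ) < 2)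
      simpa using this
    have := h1.mul ((h2.const_add 1).div_const 2)
    refine this.congr_deriv ?_
    simp
    ring
  have hneg : Real.log 2 * (b - 1 / 2) < 0 :=
    mul_neg_of_pos_of_neg (Real.log_pos (by norm_num)) (by linarith)
  have hev := (hasDerivAt_iff_tendsto_slope_zero.1 hd).eventually (gt_mem_nhds hneg)
  have hev' : ∀ᶠ r in nhdsWithin (0 : ℝ) (Set.Ioi 0), r⁻¹ * ((2 : ℝ) ^ (b * r) *
      ((1 + 2 ^ (-r)) / 2) - 1) < 0 := by
    refine (hev.filter_mono (nhdsWithin_mono (0 : ℝ)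
      (fun x (hx : 0 < x) => hx.ne' : Set.Ioi (0 : ℝ) ⊆ {0}ᶜ))).mono ?_
    intro r hr
    simpa using hr
  obtain ⟨r, h, hr⟩ := (hev'.and self_mem_nhdsWithin).exists
  refine ⟨r, hr, ?_⟩
  have hr' : (0 : ℝ) < r⁻¹ := inv_pos.2 hr
  by_contra hcon
  push Not at hcon
  have := mul_nonneg hr'.le (sub_nonneg.2 hcon)
  linarith

/-- Fast polarization: a quantity that squares along `σ` and grows linearly along `τ`, once small,
is doubly exponentially small after `k` steps outside an event of small probability. -/
lemma exists_treeAvg_exceed_le {C β η : ℝ} (hC : 2 ≤ C) (hβ0 : 0 < β) (hβ : β < 1 / 2)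
    (hη : 0 < η) :
    ∃ δ : ℝ, 0 < δ ∧ ∃ N : ℕ, ∀ {S : Type*} (σ τ : S → S) (f : S → ℝ), (∀ s, 0 ≤ f s) →
      (∀ s, f (σ s) ≤ f s ^ 2) → (∀ s, f (τ s) ≤ C * f s) → ∀ s, f s ≤ δ → ∀ k, N ≤ k →
      treeAvg σ τ k (fun x => if (2 : ℝ) ^ (-((2 : ℝ) ^ (β * k))) < f x then 1 else 0) s ≤ η := by
  obtain ⟨b, hβb, hb⟩ := exists_between hβ
  have hb0 : 0 < b := hβ0.trans hβb
  obtain ⟨r, hr, hr1⟩ := exists_rpow_mean_lt_one hb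
  set x := (2 : ℝ) ^ (b * r) * ((1 + 2 ^ (-r)) / 2) with hx
  have hx0 : 0 ≤ x := by positivity
  obtain ⟨L, hL⟩ := exists_nat_gt (β / (b - β))
  have hLβ : β * (L + 1) ≤ b * L := by
    rw [div_lt_iff₀ (by linarith)] at hL
    nlinarith
  have hL0 : 0 < (L : ℝ) := lt_of_le_of_lt (div_nonneg hβ0.le (by linarith)) hL
  have hL1 : 1 ≤ L := by exact_mod_cast hL0
  have hlC : 0 < Real.log C := Real.log_pos (by linarith)
  -- exponent of the potential in the first phase
  set p := Real.log (5 / 4) / (L * Real.log C) with hp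
  have hp0 : 0 < p := div_pos (Real.log_pos (by norm_num)) (by positivity)
  have hCp : (C ^ p) ^ L = 5 / 4 := by
    rw [← Real.rpow_natCast, ← Real.rpow_mul (by linarith), Real.rpow_def_of_pos (by linarith)]
    rw [hp, show Real.log C * (Real.log (5 / 4) / (L * Real.log C) * L) = Real.log (5 / 4) by
      field_simp]
    exact Real.exp_log (by norm_num)
  have hCp1 : 1 ≤ C ^ p := Real.one_le_rpow (by linarith) hp0.le
  have hCp2 : C ^ p ≤ 5 / 4 := by
    rw [← hCp]; exact le_self_pow₀ hCp1 (by omega)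
  set d := (1 / 4 : ℝ) ^ p⁻¹ with hd
  have hd0 : 0 < d := by positivity
  have hdp : d ^ p = 1 / 4 := by
    rw [hd, ← Real.rpow_mul (by norm_num), inv_mul_cancel₀ hp0.ne', Real.rpow_one]
  set δ := min 1 (d * (η / 3) ^ p⁻¹) with hδ
  have hδ0 : 0 < δ := lt_min one_pos (by positivity)
  have hδη : (δ / d) ^ p ≤ η / 3 := by
    calc (δ / d) ^ p ≤ ((η / 3) ^ p⁻¹) ^ p := by
          refine Real.rpow_le_rpow (by positivity) ?_ hp0.le
          rw [div_le_iff₀ hd0, mul_comm]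
          exact min_le_right _ _
      _ = η / 3 := by
          rw [← Real.rpow_mul (by positivity), inv_mul_cancel₀ hp0.ne', Real.rpow_one]
  have hkdiv : Tendsto (fun k : ℕ => k / (L + 1) + 1) atTop atTop :=
    (tendsto_add_atTop_nat 1).comp (Nat.tendsto_div_const_atTop L.succ_ne_zero)
  have hksub : Tendsto (fun k : ℕ => k - (k / (L + 1) + 1)) atTop atTop := by
    refine tendsto_atTop_mono (f := fun k => k / (L + 1) - 1) (fun k => ?_)
      ((tendsto_sub_atTop_nat 1).comp (Nat.tendsto_div_const_atTop L.succ_ne_zero))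
    have := Nat.div_add_mod k (L + 1)
    have h2 : 2 * (k / (L + 1)) ≤ (L + 1) * (k / (L + 1)) := Nat.mul_le_mul_right _ (by omega)
    omega
  have t1 : Tendsto (fun k : ℕ => 2 ^ p * (15 / 16 : ℝ) ^ (k / (L + 1) + 1)) atTop (nhds 0) := by
    simpa using ((tendsto_pow_atTop_nhds_zero_of_lt_one (by norm_num : (0 : ℝ) ≤ 15 / 16)
      (by norm_num)).comp hkdiv).const_mul (2 ^ p)
  have t2 : Tendsto (fun k : ℕ => 2 ^ (b * r) * x ^ (k - (k / (L + 1) + 1))) atTop (nhds 0) := by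
    simpa using ((tendsto_pow_atTop_nhds_zero_of_lt_one hx0 hr1).comp hksub).const_mul
      (2 ^ (b * r))
  have hη3 : (0 : ℝ) < η / 3 := by positivity
  obtain ⟨N, hN⟩ := eventually_atTop.1 (((t1.eventually (gt_mem_nhds hη3)).and
    (t2.eventually (gt_mem_nhds hη3))).and (eventually_ge_atTop 2))
  refine ⟨δ, hδ0, N, fun {S} σ τ f hf hσ hτ s hs k hk => ?_⟩
  obtain ⟨⟨hk1, hk2⟩, hk3⟩ := hN k hk
  set k₁ := k / (L + 1) + 1 with hk₁
  set k₂ := k - k₁ with hk₂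
  have hdm := Nat.div_add_mod k (L + 1)
  have hml := Nat.mod_lt k (Nat.succ_pos L)
  have hle : k₁ ≤ k := by
    have h2 : 2 * (k / (L + 1)) ≤ (L + 1) * (k / (L + 1)) := Nat.mul_le_mul_right _ (by omega)
    omega
  have hkk : k = k₁ + k₂ := by omega
  have hexp : (L + 1) * k₁ = (L + 1) * (k / (L + 1)) + (L + 1) := by rw [hk₁]; ring
  have h12 : k₂ ≤ L * k₁ := by
    have : (L + 1) * k₁ = L * k₁ + k₁ := by ring
    simp only [Nat.succ_eq_add_one] at hml
    omega
  have h21 : L * k ≤ (L + 1) * (k₂ + 1) := by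
    have e1 : (L + 1) * (k₂ + 1) + (L + 1) * k₁ = (L + 1) * k + (L + 1) := by
      rw [hkk]; ring
    have e2 : (L + 1) * k = L * k + k := by ring
    omega
  set t := (2 : ℝ) ^ (β * k) with ht
  have ht0 : 0 < t := by positivity
  set θ := (2 : ℝ)⁻¹ * (C ^ k₂)⁻¹ with hθ
  have hCk : 0 < C ^ k₂ := by positivity
  have hθ0 : 0 < θ := by positivity
  -- second phase
  have step2 : ∀ y, treeAvg σ τ k₂ (fun x => if (2 : ℝ) ^ (-t) < f x then 1 else 0) y
      ≤ (if θ < f y then 1 else 0) + t ^ r * ((1 + 2 ^ (-r)) / 2) ^ k₂ := by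
    intro y
    split_ifs with h
    · have : treeAvg σ τ k₂ (fun x => if (2 : ℝ) ^ (-t) < f x then (1 : ℝ) else 0) y ≤ 1 := by
        refine (treeAvg_mono (h := fun _ => 1) (fun x => ?_) _ _).trans (treeAvg_const 1 _ _).le
        split_ifs <;> norm_num
      have : 0 ≤ t ^ r * ((1 + 2 ^ (-r)) / 2) ^ k₂ := by positivity
      linarith
    · rw [zero_add]
      have := treeAvg_exceed_le_doubling hf hσ hτ (by linarith) hr ht0 k₂ 1 one_pos y (by
        rw [Real.rpow_neg_one]
        calc C ^ k₂ * f y ≤ C ^ k₂ * θ := mul_le_mul_of_nonneg_left (not_lt.1 h) hCk.le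
          _ = 2⁻¹ := by rw [hθ]; field_simp)
      simpa using this
  have step1 := treeAvg_exceed_le_geometric hf hσ hτ (by linarith) hd0 hp0 (q := 3 / 4)
    (by rw [hdp]; linarith) (by norm_num) hθ0 k₁ s
  have b1 : (f s / d) ^ p ≤ η / 3 := by
    refine le_trans (Real.rpow_le_rpow (div_nonneg (hf s) hd0.le) ?_ hp0.le) hδη
    exact div_le_div_of_nonneg_right hs hd0.le
  have b2 : (3 / 4 : ℝ) ^ k₁ * (f s / θ) ^ p ≤ 2 ^ p * (15 / 16) ^ k₁ := by
    have : (f s / θ) ^ p ≤ 2 ^ p * (5 / 4) ^ k₁ := by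
      calc (f s / θ) ^ p ≤ (1 / θ) ^ p :=
            Real.rpow_le_rpow (div_nonneg (hf s) hθ0.le) (div_le_div_of_nonneg_right
              (hs.trans (min_le_left _ _)) hθ0.le) hp0.le
        _ = (2 * C ^ k₂) ^ p := by rw [hθ]; congr 1; field_simp
        _ = 2 ^ p * (C ^ p) ^ k₂ := by
            rw [Real.mul_rpow (by norm_num) hCk.le, ← Real.rpow_natCast, ← Real.rpow_natCast,
              ← Real.rpow_mul (by linarith), ← Real.rpow_mul (by linarith), mul_comm (k₂ : ℝ)]
        _ ≤ 2 ^ p * (C ^ p) ^ (L * k₁) :=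
            mul_le_mul_of_nonneg_left (pow_le_pow_right₀ hCp1 h12) (by positivity)
        _ = _ := by rw [pow_mul, hCp]
    calc _ ≤ (3 / 4 : ℝ) ^ k₁ * (2 ^ p * (5 / 4) ^ k₁) :=
          mul_le_mul_of_nonneg_left this (by positivity)
      _ = 2 ^ p * ((3 / 4) ^ k₁ * (5 / 4) ^ k₁) := by ring
      _ = _ := by rw [← mul_pow]; norm_num
  have b3 : t ^ r * ((1 + 2 ^ (-r)) / 2) ^ k₂ ≤ 2 ^ (b * r) * x ^ k₂ := by
    have : t ^ r ≤ 2 ^ (b * r) * (2 ^ (b * r)) ^ k₂ := by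
      rw [ht, ← Real.rpow_mul (by norm_num), ← Real.rpow_natCast, ← Real.rpow_mul (by norm_num),
        ← Real.rpow_add (by norm_num)]
      refine Real.rpow_le_rpow_of_exponent_le (by norm_num) ?_
      have h21' : (L : ℝ) * k ≤ (L + 1) * (k₂ + 1) := by exact_mod_cast h21
      have : β * k ≤ b * (k₂ + 1) := by
        have hm : L * (β * k) ≤ L * (b * (k₂ + 1)) := by
          calc L * (β * k) = β * (L * k) := by ring
            _ ≤ β * ((L + 1) * (k₂ + 1)) := mul_le_mul_of_nonneg_left h21' hβ0.le
            _ = (β * (L + 1)) * (k₂ + 1) := by ring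
            _ ≤ (b * L) * (k₂ + 1) := mul_le_mul_of_nonneg_right hLβ (by positivity)
            _ = _ := by ring
        exact le_of_mul_le_mul_left hm hL0
      nlinarith
    calc _ ≤ 2 ^ (b * r) * (2 ^ (b * r)) ^ k₂ * ((1 + 2 ^ (-r)) / 2) ^ k₂ :=
          mul_le_mul_of_nonneg_right this (by positivity)
      _ = _ := by rw [hx, mul_pow]; ring
  calc treeAvg σ τ k (fun x => if (2 : ℝ) ^ (-t) < f x then 1 else 0) s
      = treeAvg σ τ k₁ (treeAvg σ τ k₂ fun x => if (2 : ℝ) ^ (-t) < f x then 1 else 0) s := by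
        rw [← treeAvg_add_index, ← hkk]
    _ ≤ _ := treeAvg_mono step2 _ _
    _ = treeAvg σ τ k₁ (fun y => if θ < f y then 1 else 0) s
        + t ^ r * ((1 + 2 ^ (-r)) / 2) ^ k₂ := by rw [treeAvg_add, treeAvg_const]
    _ ≤ η := by linarith

/-- A `[0, 1]`-valued quantity that squares along `σ` and increases along `τ`, without growing on
average, polarizes to `{0, 1}`. -/
lemma tendsto_treeAvg_polarize {z : S → ℝ} (h0 : ∀ s, 0 ≤ z s) (h1 : ∀ s, z s ≤ 1)
    (hσ : ∀ s, z (σ s) ≤ z s ^ 2) (hτ : ∀ s, z s ≤ z (τ s))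
    (hτ' : ∀ s, z (τ s) ≤ 2 * z s - z s ^ 2) (s : S) :
    Tendsto (fun k => treeAvg σ τ k (fun x => (z x * (1 - z x)) ^ 2) s) atTop (nhds 0) := by
  have hstep : ∀ x, (1 - z x) ^ 2 + 1 / 4 * (z x * (1 - z x)) ^ 2
      ≤ treeAvg σ τ 1 (fun y => (1 - z y) ^ 2) x := by
    intro x
    simp only [treeAvg]
    have e0 := h0 x
    have e1 := h1 x
    have e2 := hσ x
    have e3 := hτ x
    have e4 := hτ' x
    have hsum : 2 * (1 - z x) ≤ (1 - z (σ x)) + (1 - z (τ x)) := by linarith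
    have hdiff : z x * (1 - z x) ≤ (1 - z (σ x)) - (1 - z (τ x)) := by nlinarith
    have hs2 := pow_le_pow_left₀ (by linarith : 0 ≤ 2 * (1 - z x)) hsum 2
    have hd2 := pow_le_pow_left₀ (mul_nonneg e0 (by linarith)) hdiff 2
    nlinarith
  set a := fun k => treeAvg σ τ k (fun y => (1 - z y) ^ 2) s with ha
  have hinc : ∀ k, a k + 1 / 4 * treeAvg σ τ k (fun x => (z x * (1 - z x)) ^ 2) s ≤ a (k + 1) := by
    intro k
    simp only [ha]
    rw [treeAvg_add_index k 1, ← treeAvg_const_mul, ← treeAvg_add]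
    exact treeAvg_mono hstep k s
  have hpos : ∀ k, 0 ≤ treeAvg σ τ k (fun x => (z x * (1 - z x)) ^ 2) s := by
    intro k
    refine le_trans (treeAvg_const 0 k s).ge (treeAvg_mono (fun x => ?_) k s)
    positivity
  have hmono : Monotone a := monotone_nat_of_le_succ fun k => by linarith [hinc k, hpos k]
  have hbdd : BddAbove (Set.range a) := by
    refine ⟨1, ?_⟩
    rintro _ ⟨k, rfl⟩
    refine (treeAvg_mono (h := fun _ => 1) (fun x => ?_) k s).trans (treeAvg_const 1 k s).le
    nlinarith [h0 x, h1 x]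
  have hlim := tendsto_atTop_ciSup hmono hbdd
  have hdiff : Tendsto (fun k => 4 * (a (k + 1) - a k)) atTop (nhds 0) := by
    simpa using (((tendsto_add_atTop_iff_nat 1).2 hlim).sub hlim).const_mul 4
  exact squeeze_zero hpos (fun k => by linarith [hinc k]) hdiff

end TreeAvg

/-! ### Entropy of unnormalized weights -/

/-- Entropy, in nats and homogeneous of degree one, of a weight function on a finite type. -/
noncomputable def weightEnt {ι : Type*} [Fintype ι] (q : ι → ℝ) : ℝ :=
  ∑ x, Real.negMulLog (q x) - Real.negMulLog (∑ x, q x)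

/-- Image of a weight function under a map. -/
noncomputable def pushWeight {ι κ : Type*} [Fintype ι] (g : ι → κ) (q : ι → ℝ) (y : κ) : ℝ :=
  ∑ x with g x = y, q x

section WeightEnt

variable {ι κ : Type*}

lemma negMulLog_le_tangent {q c : ℝ} (hq : 0 ≤ q) (hc : 0 < c) :
    Real.negMulLog q ≤ c - q - q * Real.log c := by
  rcases hq.eq_or_lt with rfl | hq
  · simp [hc.le]
  · have h := Real.log_le_sub_one_of_pos (div_pos hc hq)
    rw [Real.log_div hc.ne' hq.ne'] at h
    have h2 := mul_le_mul_of_nonneg_left h hq.le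
    have e : q * (c / q - 1) = c - q := by field_simp
    rw [Real.negMulLog]
    nlinarith

lemma le_negMulLog_of_pos {q c : ℝ} (hq : 0 ≤ q) (hc : 0 < c) :
    q - q ^ 2 / c - q * Real.log c ≤ Real.negMulLog q := by
  rcases hq.eq_or_lt with rfl | hq
  · simp
  · have h := Real.log_le_sub_one_of_pos (div_pos hq hc)
    rw [Real.log_div hq.ne' hc.ne'] at h
    have h2 := mul_le_mul_of_nonneg_left h hq.le
    have e : q * (q / c - 1) = q ^ 2 / c - q := by field_simp
    rw [Real.negMulLog]
    nlinarith

lemma negMulLog_sum_le (I : Finset ι) {q : ι → ℝ} (hq : ∀ x ∈ I, 0 ≤ q x) :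
    Real.negMulLog (∑ x ∈ I, q x) ≤ ∑ x ∈ I, Real.negMulLog (q x) := by
  rw [Real.negMulLog, neg_mul, Finset.sum_mul, ← Finset.sum_neg_distrib]
  refine Finset.sum_le_sum fun x hx => ?_
  rcases (hq x hx).eq_or_lt with h | h
  · simp [← h]
  · rw [Real.negMulLog, neg_mul, neg_le_neg_iff]
    exact mul_le_mul_of_nonneg_left (Real.log_le_log h (Finset.single_le_sum hq hx)) h.le

lemma sum_negMulLog_le (I : Finset ι) {q : ι → ℝ} (hq : ∀ x ∈ I, 0 ≤ q x) {N : ℕ}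
    (hI : I.card ≤ N) :
    ∑ x ∈ I, Real.negMulLog (q x)
      ≤ Real.negMulLog (∑ x ∈ I, q x) + (∑ x ∈ I, q x) * Real.log N := by
  rcases (Finset.sum_nonneg hq).eq_or_lt with h | h
  · have h0 := (Finset.sum_eq_zero_iff_of_nonneg hq).1 h.symm
    rw [← h, Finset.sum_eq_zero fun x hx => by rw [h0 x hx, Real.negMulLog_zero]]
    simp
  · set s := ∑ x ∈ I, q x with hs
    have hI0 : 0 < I.card := by
      rw [Finset.card_pos, Finset.nonempty_iff_ne_empty]
      rintro rfl
      simp [hs] at h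
    have hN : (0 : ℝ) < N := by exact_mod_cast hI0.trans_le hI
    calc ∑ x ∈ I, Real.negMulLog (q x)
        ≤ ∑ x ∈ I, (s / N - q x - q x * Real.log (s / N)) :=
          Finset.sum_le_sum fun x hx => negMulLog_le_tangent (hq x hx) (div_pos h hN)
      _ = I.card * (s / N) - s - s * Real.log (s / N) := by
          rw [Finset.sum_sub_distrib, Finset.sum_sub_distrib, ← Finset.sum_mul]
          simp [hs]
      _ ≤ s - s - s * Real.log (s / N) := by
          have : (I.card : ℝ) * (s / N) ≤ N * (s / N) :=
            mul_le_mul_of_nonneg_right (by exact_mod_cast hI) (div_pos h hN).le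
          rw [mul_div_cancel₀ _ hN.ne'] at this
          linarith
      _ = _ := by rw [Real.log_div h.ne' hN.ne', Real.negMulLog]; ring

variable [Fintype ι]

lemma pushWeight_nonneg (g : ι → κ) {q : ι → ℝ} (hq : ∀ x, 0 ≤ q x) (y : κ) :
    0 ≤ pushWeight g q y :=
  Finset.sum_nonneg fun x _ => hq x

lemma weightEnt_nonneg {q : ι → ℝ} (hq : ∀ x, 0 ≤ q x) : 0 ≤ weightEnt q :=
  sub_nonneg.2 (negMulLog_sum_le _ fun x _ => hq x)

lemma weightEnt_le_log_card {q : ι → ℝ} (hq : ∀ x, 0 ≤ q x) :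
    weightEnt q ≤ (∑ x, q x) * Real.log (Fintype.card ι) := by
  have := sum_negMulLog_le Finset.univ (fun x _ => hq x) (Finset.card_univ (α := ι)).le
  rw [weightEnt]
  linarith

variable [Fintype κ]

lemma sum_pushWeight (g : ι → κ) (q : ι → ℝ) : ∑ y, pushWeight g q y = ∑ x, q x :=
  Finset.sum_fiberwise _ _ _

lemma weightEnt_pushWeight_le (g : ι → κ) {q : ι → ℝ} (hq : ∀ x, 0 ≤ q x) :
    weightEnt (pushWeight g q) ≤ weightEnt q := by
  rw [weightEnt, weightEnt, sum_pushWeight]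
  refine sub_le_sub_right ?_ _
  rw [← Finset.sum_fiberwise Finset.univ g fun x => Real.negMulLog (q x)]
  exact Finset.sum_le_sum fun y _ => negMulLog_sum_le _ fun x _ => hq x

lemma weightEnt_le_pushWeight_add (g : ι → κ) {q : ι → ℝ} (hq : ∀ x, 0 ≤ q x) {N : ℕ}
    (hN : ∀ y, (Finset.univ.filter fun x => g x = y).card ≤ N) :
    weightEnt q ≤ weightEnt (pushWeight g q) + (∑ x, q x) * Real.log N := by
  rw [weightEnt, weightEnt, sum_pushWeight, ← sum_pushWeight g q, Finset.sum_mul,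
    ← Finset.sum_fiberwise Finset.univ g fun x => Real.negMulLog (q x)]
  have : ∑ y, ∑ x with g x = y, Real.negMulLog (q x)
      ≤ ∑ y, (Real.negMulLog (pushWeight g q y) + pushWeight g q y * Real.log N) :=
    Finset.sum_le_sum fun y _ => sum_negMulLog_le _ (fun x _ => hq x) (hN y)
  rw [Finset.sum_add_distrib] at this
  linarith

lemma pushWeight_comp {κ' : Type*} (g : ι → κ) (h : κ → κ') (q : ι → ℝ) :
    pushWeight h (pushWeight g q) = pushWeight (h ∘ g) q := by
  funext y
  simp only [pushWeight, Finset.sum_filter, Function.comp_apply]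
  simp only [← Finset.sum_filter (p := fun x => g x = _)]
  rw [← Finset.sum_fiberwise Finset.univ g fun x => if h (g x) = y then q x else 0]
  refine Finset.sum_congr rfl fun z _ => ?_
  split_ifs with hz
  · exact Finset.sum_congr rfl fun x hx => by
      rw [(Finset.mem_filter.1 hx).2, if_pos hz]
  · exact (Finset.sum_eq_zero fun x hx => by rw [(Finset.mem_filter.1 hx).2, if_neg hz]).symm

/-- If any two distinct outcomes have small geometric mean, then the entropy is small. -/
lemma weightEnt_le_of_sqrt_mul_le {q : ι → ℝ} (hq : ∀ x, 0 ≤ q x) {c : ℝ} (hc : 0 ≤ c)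
    (h : ∀ x y, x ≠ y → Real.sqrt (q x * q y) ≤ c) :
    weightEnt q ≤ 2 * (Fintype.card ι) ^ 2 * c := by
  set s := ∑ x, q x with hs
  set R := Real.sqrt s with hR
  set Q := ∑ x, Real.sqrt (q x) with hQ
  have hs0 : 0 ≤ s := Finset.sum_nonneg fun x _ => hq x
  have hRR : R * R = s := Real.mul_self_sqrt hs0
  have hR0 : 0 ≤ R := Real.sqrt_nonneg _
  have hQQ : Q * Q = ∑ x, ∑ y, Real.sqrt (q x * q y) := by
    rw [hQ, Finset.sum_mul_sum]
    exact Finset.sum_congr rfl fun x _ => Finset.sum_congr rfl fun y _ =>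
      (Real.sqrt_mul (hq x) _).symm
  have hRQ : R ≤ Q := by
    refine Real.sqrt_le_iff.2 ⟨Finset.sum_nonneg fun _ _ => Real.sqrt_nonneg _, ?_⟩
    rw [sq, hQQ]
    refine Finset.sum_le_sum fun x _ => ?_
    refine le_trans ?_ (Finset.single_le_sum (f := fun y => Real.sqrt (q x * q y))
      (fun _ _ => Real.sqrt_nonneg _) (Finset.mem_univ x))
    rw [Real.sqrt_mul_self (hq x)]
  have hpair : Q * Q - s ≤ (Fintype.card ι) ^ 2 * c := by
    have : Q * Q ≤ ∑ x, ∑ y, ((if x = y then q x else 0) + c) := by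
      rw [hQQ]
      refine Finset.sum_le_sum fun x _ => Finset.sum_le_sum fun y _ => ?_
      split_ifs with hxy
      · rw [← hxy, Real.sqrt_mul_self (hq x)]; linarith
      · simpa using h x y hxy
    simp only [Finset.sum_add_distrib, Finset.sum_ite_eq, Finset.mem_univ, if_true,
      Finset.sum_const, Finset.card_univ, nsmul_eq_mul] at this
    nlinarith
  have hterm : ∀ x, Real.negMulLog (q x) + q x * Real.log s
      ≤ 2 * (R * Real.sqrt (q x) - q x) := by
    intro x
    rcases (hq x).eq_or_lt with hx | hx
    · simp [← hx]
    · have hsx : 0 < s := hx.trans_le (Finset.single_le_sum (fun y _ => hq y) (Finset.mem_univ x))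
      have hr : 0 < Real.sqrt (q x) := Real.sqrt_pos.2 hx
      have hRp : 0 < R := Real.sqrt_pos.2 hsx
      have hl := Real.log_le_sub_one_of_pos (div_pos hRp hr)
      rw [Real.log_div hRp.ne' hr.ne', hR, Real.log_sqrt hs0, Real.log_sqrt hx.le, ← hR] at hl
      have hm := mul_le_mul_of_nonneg_left hl hx.le
      have e : q x * (R / Real.sqrt (q x) - 1) = R * Real.sqrt (q x) - q x := by
        have : q x = Real.sqrt (q x) * Real.sqrt (q x) := (Real.mul_self_sqrt hx.le).symm
        field_simp
        linear_combination R * this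
      rw [e] at hm
      rw [Real.negMulLog]
      linarith
  have hent : weightEnt q ≤ 2 * (R * Q - s) := by
    have := Finset.sum_le_sum fun x (_ : x ∈ Finset.univ) => hterm x
    rw [Finset.sum_add_distrib, ← Finset.sum_mul, ← Finset.mul_sum, Finset.sum_sub_distrib,
      ← Finset.mul_sum] at this
    rw [weightEnt, Real.negMulLog]
    linarith
  nlinarith

end WeightEnt

/-! ### Real characters and Fourier transform on `F₂^m` -/

/-- The vector space `F₂^m`. -/
abbrev F2Vec (m : ℕ) := Fin m → ZMod 2

/-- The nontrivial real character of `F₂`. -/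
noncomputable def f2Sign (x : ZMod 2) : ℝ := if x = 0 then 1 else -1

lemma f2_cases (x : ZMod 2) : x = 0 ∨ x = 1 := by
  revert x; decide

lemma f2Sign_zero : f2Sign 0 = 1 := by simp [f2Sign]

lemma f2Sign_one : f2Sign 1 = -1 := by simp [f2Sign]

lemma f2Sign_add (x y : ZMod 2) : f2Sign (x + y) = f2Sign x * f2Sign y := by
  have h2 : (1 + 1 : ZMod 2) = 0 := by decide
  rcases f2_cases x with rfl | rfl <;> rcases f2_cases y with rfl | rfl <;>
    simp [f2Sign_zero, f2Sign_one, h2]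

lemma abs_f2Sign (x : ZMod 2) : |f2Sign x| = 1 := by
  rcases f2_cases x with rfl | rfl <;> simp [f2Sign_zero, f2Sign_one]

/-- The real character of `F₂^m` with frequency `a`. -/
noncomputable def f2Char {m : ℕ} (a v : F2Vec m) : ℝ := f2Sign (a ⬝ᵥ v)

/-- Fourier transform of a weight function on `F₂^m`. -/
noncomputable def f2Fourier {m : ℕ} (q : F2Vec m → ℝ) (a : F2Vec m) : ℝ := ∑ v, f2Char a v * q v

/-- Pointwise Bhattacharyya parameter of the linear functional `a` under the weight `q`. -/
noncomputable def bhatt {m : ℕ} (q : F2Vec m → ℝ) (a : F2Vec m) : ℝ :=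
  Real.sqrt ((∑ v, q v) ^ 2 - f2Fourier q a ^ 2)

/-- Weight of the sum of two independent vectors. -/
noncomputable def convWeight {m : ℕ} (q q' : F2Vec m → ℝ) (u : F2Vec m) : ℝ :=
  ∑ v, q (u + v) * q' v

section Fourier

variable {m : ℕ} {q q' : F2Vec m → ℝ}

lemma f2Vec_add_self (u : F2Vec m) : u + u = 0 := by
  funext i
  exact CharTwo.add_self_eq_zero (u i)

lemma f2Vec_add_add_cancel (u v : F2Vec m) : u + v + v = u := by
  rw [add_assoc, f2Vec_add_self, add_zero]

lemma sum_add_right_f2Vec (h : F2Vec m → ℝ) (v : F2Vec m) : ∑ u, h (u + v) = ∑ u, h u :=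
  Fintype.sum_equiv (Equiv.addRight v) _ _ fun _ => rfl

lemma f2Char_add_right (a u v : F2Vec m) : f2Char a (u + v) = f2Char a u * f2Char a v := by
  rw [f2Char, dotProduct_add, f2Sign_add]; rfl

lemma f2Char_add_left (a b v : F2Vec m) : f2Char (a + b) v = f2Char a v * f2Char b v := by
  rw [f2Char, add_dotProduct, f2Sign_add]; rfl

lemma abs_f2Char (a v : F2Vec m) : |f2Char a v| = 1 := abs_f2Sign _

lemma f2Char_eq_or (a v : F2Vec m) : f2Char a v = 1 ∨ f2Char a v = -1 := by
  rw [f2Char]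
  rcases f2_cases (a ⬝ᵥ v) with h | h <;> simp [h, f2Sign_zero, f2Sign_one]

lemma f2Char_zero_right (a : F2Vec m) : f2Char a 0 = 1 := by
  simp [f2Char, f2Sign_zero]

lemma sum_f2Char (v : F2Vec m) : ∑ a, f2Char a v = if v = 0 then (2 : ℝ) ^ m else 0 := by
  split_ifs with h
  · simp [h, f2Char_zero_right]
  · obtain ⟨i, hi⟩ := Function.ne_iff.1 h
    have hi1 : v i = 1 := (f2_cases (v i)).resolve_left hi
    have key : ∑ a : F2Vec m, f2Char (a + Pi.single i 1) v = ∑ a : F2Vec m, f2Char a v :=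
      sum_add_right_f2Vec (fun a => f2Char a v) _
    have h1 : f2Char (Pi.single i 1) v = -1 := by
      rw [f2Char, single_dotProduct, hi1, one_mul, f2Sign_one]
    simp only [f2Char_add_left, h1, ← Finset.sum_mul] at key
    linarith

lemma abs_f2Fourier_le (hq : ∀ v, 0 ≤ q v) (a : F2Vec m) : |f2Fourier q a| ≤ ∑ v, q v := by
  refine (Finset.abs_sum_le_sum_abs _ _).trans (le_of_eq ?_)
  exact Finset.sum_congr rfl fun v _ => by rw [abs_mul, abs_f2Char, one_mul, abs_of_nonneg (hq v)]

lemma f2Fourier_sq_le (hq : ∀ v, 0 ≤ q v) (a : F2Vec m) : f2Fourier q a ^ 2 ≤ (∑ v, q v) ^ 2 :=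
  sq_le_sq' (abs_le.1 (abs_f2Fourier_le hq a)).1 (abs_le.1 (abs_f2Fourier_le hq a)).2

lemma bhatt_nonneg (q : F2Vec m → ℝ) (a : F2Vec m) : 0 ≤ bhatt q a := Real.sqrt_nonneg _

lemma bhatt_sq (hq : ∀ v, 0 ≤ q v) (a : F2Vec m) :
    bhatt q a ^ 2 = (∑ v, q v) ^ 2 - f2Fourier q a ^ 2 :=
  Real.sq_sqrt (sub_nonneg.2 (f2Fourier_sq_le hq a))

lemma bhatt_le_sum (hq : ∀ v, 0 ≤ q v) (a : F2Vec m) : bhatt q a ≤ ∑ v, q v := by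
  refine Real.sqrt_le_iff.2 ⟨Finset.sum_nonneg fun v _ => hq v, ?_⟩
  linarith [sq_nonneg (f2Fourier q a)]

lemma f2Fourier_inversion (q : F2Vec m → ℝ) (v : F2Vec m) :
    ∑ a, f2Char a v * f2Fourier q a = 2 ^ m * q v := by
  simp only [f2Fourier, Finset.mul_sum]
  rw [Finset.sum_comm]
  have : ∀ u, ∑ a, f2Char a v * (f2Char a u * q u) = if v + u = 0 then 2 ^ m * q u else 0 := by
    intro u
    simp only [← mul_assoc, ← f2Char_add_right, ← Finset.sum_mul]
    rw [sum_f2Char]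
    split_ifs <;> simp
  simp only [this]
  rw [Finset.sum_eq_single v]
  · simp [f2Vec_add_self]
  · intro u _ huv
    rw [if_neg]
    intro h
    exact huv (by rw [← f2Vec_add_add_cancel u v, add_comm u v, h, zero_add])
  · simp

lemma sum_f2Fourier_sq (q : F2Vec m → ℝ) : ∑ a, f2Fourier q a ^ 2 = 2 ^ m * ∑ v, q v ^ 2 := by
  have : ∀ a, f2Fourier q a ^ 2 = ∑ v, (f2Char a v * f2Fourier q a) * q v := by
    intro a
    rw [sq]
    nth_rewrite 1 [f2Fourier]
    rw [Finset.sum_mul]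
    exact Finset.sum_congr rfl fun v _ => by ring
  simp only [this]
  rw [Finset.sum_comm]
  simp only [← Finset.sum_mul, f2Fourier_inversion, Finset.mul_sum]
  exact Finset.sum_congr rfl fun v _ => by ring

lemma sum_convWeight (q q' : F2Vec m → ℝ) :
    ∑ u, convWeight q q' u = (∑ v, q v) * ∑ v, q' v := by
  simp only [convWeight]
  rw [Finset.sum_comm]
  simp only [← Finset.sum_mul, sum_add_right_f2Vec, Finset.mul_sum]

lemma convWeight_nonneg (hq : ∀ v, 0 ≤ q v) (hq' : ∀ v, 0 ≤ q' v) (u : F2Vec m) :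
    0 ≤ convWeight q q' u :=
  Finset.sum_nonneg fun v _ => mul_nonneg (hq _) (hq' v)

lemma f2Fourier_convWeight (q q' : F2Vec m → ℝ) (a : F2Vec m) :
    f2Fourier (convWeight q q') a = f2Fourier q a * f2Fourier q' a := by
  simp only [f2Fourier, convWeight, Finset.mul_sum]
  rw [Finset.sum_comm]
  refine Finset.sum_congr rfl fun v _ => ?_
  have : ∀ u, f2Char a u * (q (u + v) * q' v)
      = (f2Char a (u + v) * q (u + v)) * (f2Char a v * q' v) := by
    intro u
    have h : f2Char a v * f2Char a v = 1 := by
      rcases f2Char_eq_or a v with h | h <;> simp [h]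
    rw [f2Char_add_right]
    linear_combination (-(f2Char a u * q (u + v) * q' v)) * h
  simp only [this]
  rw [← Finset.sum_mul, sum_add_right_f2Vec fun u => f2Char a u * q u]

lemma bhatt_convWeight_sq (hq : ∀ v, 0 ≤ q v) (hq' : ∀ v, 0 ≤ q' v) (a : F2Vec m) :
    bhatt (convWeight q q') a ^ 2 = (∑ v, q v) ^ 2 * bhatt q' a ^ 2
      + (∑ v, q' v) ^ 2 * bhatt q a ^ 2 - bhatt q a ^ 2 * bhatt q' a ^ 2 := by
  rw [bhatt_sq (convWeight_nonneg hq hq'), bhatt_sq hq, bhatt_sq hq', f2Fourier_convWeight,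
    sum_convWeight]
  ring

lemma bhatt_convWeight_le (hq : ∀ v, 0 ≤ q v) (hq' : ∀ v, 0 ≤ q' v) (a : F2Vec m) :
    bhatt (convWeight q q') a
      ≤ (∑ v, q v) * bhatt q' a + (∑ v, q' v) * bhatt q a - bhatt q a * bhatt q' a := by
  have h1 := bhatt_le_sum hq a
  have h2 := bhatt_le_sum hq' a
  have h3 := bhatt_nonneg q a
  have h4 := bhatt_nonneg q' a
  refine abs_le_of_sq_le_sq' ?_ (by nlinarith) |>.2
  rw [bhatt_convWeight_sq hq hq']
  have := mul_nonneg (mul_nonneg h3 h4)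
    (mul_nonneg (sub_nonneg.2 h1) (sub_nonneg.2 h2))
  nlinarith

lemma le_bhatt_convWeight (hq : ∀ v, 0 ≤ q v) (hq' : ∀ v, 0 ≤ q' v) (a : F2Vec m) :
    (∑ v, q v) * bhatt q' a ≤ bhatt (convWeight q q') a := by
  refine abs_le_of_sq_le_sq' ?_ (bhatt_nonneg _ _) |>.2
  rw [bhatt_convWeight_sq hq hq', mul_pow]
  have h2 := pow_le_pow_left₀ (bhatt_nonneg q' a) (bhatt_le_sum hq' a) 2
  nlinarith [sq_nonneg (bhatt q a)]

/-- Weight of the event that the functional `a` takes the value `i`. -/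
noncomputable def funcWeight (q : F2Vec m → ℝ) (a : F2Vec m) (i : ZMod 2) : ℝ :=
  ∑ v, if a ⬝ᵥ v = i then q v else 0

lemma funcWeight_nonneg (hq : ∀ v, 0 ≤ q v) (a : F2Vec m) (i : ZMod 2) : 0 ≤ funcWeight q a i :=
  Finset.sum_nonneg fun v _ => by split_ifs <;> simp [hq v]

lemma funcWeight_zero_add_one (q : F2Vec m → ℝ) (a : F2Vec m) :
    funcWeight q a 0 + funcWeight q a 1 = ∑ v, q v := by
  rw [funcWeight, funcWeight, ← Finset.sum_add_distrib]
  refine Finset.sum_congr rfl fun v _ => ?_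
  rcases f2_cases (a ⬝ᵥ v) with h | h <;> simp [h]

lemma funcWeight_zero_sub_one (q : F2Vec m → ℝ) (a : F2Vec m) :
    funcWeight q a 0 - funcWeight q a 1 = f2Fourier q a := by
  rw [funcWeight, funcWeight, ← Finset.sum_sub_distrib, f2Fourier]
  refine Finset.sum_congr rfl fun v _ => ?_
  rcases f2_cases (a ⬝ᵥ v) with h | h <;> simp [f2Char, h, f2Sign_zero, f2Sign_one]

lemma bhatt_eq (q : F2Vec m → ℝ) (a : F2Vec m) :
    bhatt q a = 2 * Real.sqrt (funcWeight q a 0 * funcWeight q a 1) := by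
  rw [bhatt, ← funcWeight_zero_add_one q a, ← funcWeight_zero_sub_one q a]
  rw [show (2 : ℝ) = Real.sqrt (2 ^ 2) from (Real.sqrt_sq (by norm_num)).symm, ← Real.sqrt_mul
    (by positivity)]
  congr 1
  ring

lemma sum_funcWeight_shift (q q' : F2Vec m → ℝ) (a : F2Vec m) (i j : ZMod 2) :
    (∑ u, if a ⬝ᵥ u = i then funcWeight (fun v => q (u + v) * q' v) a j else 0)
      = funcWeight q a (i + j) * funcWeight q' a j := by
  have h1 : ∀ u, (if a ⬝ᵥ u = i then funcWeight (fun v => q (u + v) * q' v) a j else 0)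
      = ∑ v, (if a ⬝ᵥ (u + v) = i + j then q (u + v) else 0)
        * (if a ⬝ᵥ v = j then q' v else 0) := by
    intro u
    split_ifs with hu
    · refine Finset.sum_congr rfl fun v _ => ?_
      by_cases hv : a ⬝ᵥ v = j <;> simp [hv, hu, dotProduct_add]
    · refine (Finset.sum_eq_zero fun v _ => ?_).symm
      by_cases hv : a ⬝ᵥ v = j <;> simp [hv, hu, dotProduct_add]
  simp only [h1]
  rw [Finset.sum_comm]
  simp only [← Finset.sum_mul]
  simp only [sum_add_right_f2Vec fun w => if a ⬝ᵥ w = i + j then q w else 0]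
  rw [← Finset.mul_sum, funcWeight, funcWeight]

lemma sum_bhatt_shift_le (hq : ∀ v, 0 ≤ q v) (hq' : ∀ v, 0 ≤ q' v) (a : F2Vec m) :
    ∑ u, bhatt (fun v => q (u + v) * q' v) a ≤ bhatt q a * bhatt q' a := by
  set F : F2Vec m → ZMod 2 → ℝ := fun u j => funcWeight (fun v => q (u + v) * q' v) a j with hF
  have hF0 : ∀ u j, 0 ≤ F u j := fun u j =>
    funcWeight_nonneg (fun v => mul_nonneg (hq _) (hq' v)) a j
  have hi : ∀ i : ZMod 2, (∑ u, if a ⬝ᵥ u = i then Real.sqrt (F u 0 * F u 1) else 0)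
      ≤ Real.sqrt (funcWeight q a i * funcWeight q' a 0)
        * Real.sqrt (funcWeight q a (i + 1) * funcWeight q' a 1) := by
    intro i
    have hcs := Real.sum_sqrt_mul_sqrt_le Finset.univ
      (f := fun u => if a ⬝ᵥ u = i then F u 0 else 0)
      (g := fun u => if a ⬝ᵥ u = i then F u 1 else 0)
      (fun u => by split_ifs <;> simp [hF0])
      (fun u => by split_ifs <;> simp [hF0])
    rw [sum_funcWeight_shift, sum_funcWeight_shift, add_zero] at hcs
    refine le_trans (le_of_eq (Finset.sum_congr rfl fun u _ => ?_)) hcs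
    split_ifs
    · exact Real.sqrt_mul (hF0 u 0) _
    · simp
  have h11 : (1 + 1 : ZMod 2) = 0 := by decide
  have h0 := hi 0
  have h1 := hi 1
  rw [h11] at h1
  rw [zero_add] at h0
  have hsplit : ∑ u, bhatt (fun v => q (u + v) * q' v) a
      = 2 * ((∑ u, if a ⬝ᵥ u = 0 then Real.sqrt (F u 0 * F u 1) else 0)
        + ∑ u, if a ⬝ᵥ u = 1 then Real.sqrt (F u 0 * F u 1) else 0) := by
    rw [← Finset.sum_add_distrib, Finset.mul_sum]
    refine Finset.sum_congr rfl fun u _ => ?_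
    rw [bhatt_eq]
    rcases f2_cases (a ⬝ᵥ u) with h | h <;> simp [h, hF]
  have n0 := funcWeight_nonneg hq a 0
  have n1 := funcWeight_nonneg hq a 1
  have n0' := funcWeight_nonneg hq' a 0
  have n1' := funcWeight_nonneg hq' a 1
  rw [hsplit, bhatt_eq q, bhatt_eq q', Real.sqrt_mul n0, Real.sqrt_mul n0']
  rw [Real.sqrt_mul n0, Real.sqrt_mul n1] at h0
  rw [Real.sqrt_mul n1, Real.sqrt_mul n0] at h1
  nlinarith

lemma sum_abs_f2Fourier_shift_le (q q' : F2Vec m → ℝ) (a : F2Vec m) :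
    ∑ u, |f2Fourier (fun v => q (u + v) * q' v) a| ≤ ∑ c, |f2Fourier q c| * |f2Fourier q' (a + c)| := by
  have h : ∀ u, 2 ^ m * |f2Fourier (fun v => q (u + v) * q' v) a|
      ≤ ∑ c, |f2Fourier q c| * |f2Fourier q' (a + c)| := by
    intro u
    have e : 2 ^ m * f2Fourier (fun v => q (u + v) * q' v) a
        = ∑ c, f2Char c u * (f2Fourier q c * f2Fourier q' (a + c)) := by
      rw [f2Fourier, Finset.mul_sum]
      have : ∀ v, 2 ^ m * (f2Char a v * (q (u + v) * q' v))
          = ∑ c, f2Char c u * (f2Fourier q c * (f2Char (a + c) v * q' v)) := by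
        intro v
        calc 2 ^ m * (f2Char a v * (q (u + v) * q' v))
            = (2 ^ m * q (u + v)) * (f2Char a v * q' v) := by ring
          _ = _ := by
            rw [← f2Fourier_inversion, Finset.sum_mul]
            refine Finset.sum_congr rfl fun c _ => ?_
            rw [f2Char_add_right, f2Char_add_left]
            ring
      simp only [this]
      rw [Finset.sum_comm]
      refine Finset.sum_congr rfl fun c _ => ?_
      rw [← Finset.mul_sum, ← Finset.mul_sum]
      rfl
    rw [← abs_of_pos (show (0 : ℝ) < 2 ^ m by positivity), ← abs_mul, e]
    refine (Finset.abs_sum_le_sum_abs _ _).trans (le_of_eq ?_)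
    exact Finset.sum_congr rfl fun c _ => by rw [abs_mul, abs_mul, abs_f2Char, one_mul]
  have hs := Finset.sum_le_sum fun u (_ : u ∈ Finset.univ) => h u
  rw [← Finset.mul_sum, Finset.sum_const, Finset.card_univ, nsmul_eq_mul] at hs
  have hc : ((Fintype.card (F2Vec m) : ℕ) : ℝ) = 2 ^ m := by simp [F2Vec, ZMod.card]
  rw [hc] at hs
  exact le_of_mul_le_mul_left hs (by positivity)

/-- The squared Bhattacharyya parameter is subadditive in the functional. -/
lemma bhatt_add_sq_le (hq : ∀ v, 0 ≤ q v) (a b : F2Vec m) :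
    bhatt q (a + b) ^ 2 ≤ bhatt q a ^ 2 + bhatt q b ^ 2 := by
  have hexp : ∀ c, bhatt q c ^ 2 = ∑ v, ∑ w, (1 - f2Char c v * f2Char c w) * (q v * q w) := by
    intro c
    rw [bhatt_sq hq, sq, sq, f2Fourier, Finset.sum_mul_sum, Finset.sum_mul_sum,
      ← Finset.sum_sub_distrib]
    refine Finset.sum_congr rfl fun v _ => ?_
    rw [← Finset.sum_sub_distrib]
    exact Finset.sum_congr rfl fun w _ => by ring
  rw [hexp, hexp, hexp, ← Finset.sum_add_distrib]
  refine Finset.sum_le_sum fun v _ => ?_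
  rw [← Finset.sum_add_distrib]
  refine Finset.sum_le_sum fun w _ => ?_
  rw [← add_mul]
  refine mul_le_mul_of_nonneg_right ?_ (mul_nonneg (hq v) (hq w))
  rw [f2Char_add_left, f2Char_add_left]
  rcases f2Char_eq_or a v with h | h <;> rcases f2Char_eq_or a w with h' | h' <;>
    rcases f2Char_eq_or b v with h'' | h'' <;> rcases f2Char_eq_or b w with h''' | h''' <;>
    rw [h, h', h'', h'''] <;> norm_num

lemma bhatt_add_le (hq : ∀ v, 0 ≤ q v) (a b : F2Vec m) :
    bhatt q (a + b) ≤ bhatt q a + bhatt q b := by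
  have h1 := bhatt_nonneg q a
  have h2 := bhatt_nonneg q b
  refine abs_le_of_sq_le_sq' ?_ (by positivity) |>.2
  nlinarith [bhatt_add_sq_le hq a b]

lemma bhatt_zero (q : F2Vec m → ℝ) : bhatt q 0 = 0 := by
  simp [bhatt, f2Fourier, f2Char, f2Sign_zero]

end Fourier

/-! ### Entropy of linear images versus Fourier coefficients -/

section LinearImages

variable {m : ℕ} {q q' : F2Vec m → ℝ}

lemma weightEnt_convWeight_add (q q' : F2Vec m → ℝ) :
    weightEnt (convWeight q q') + ∑ u, weightEnt (fun v => q (u + v) * q' v)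
      = (∑ v, q v) * weightEnt q' + (∑ v, q' v) * weightEnt q := by
  have h1 : ∑ u, ∑ v, Real.negMulLog (q (u + v) * q' v)
      = (∑ v, q v) * ∑ v, Real.negMulLog (q' v) + (∑ v, q' v) * ∑ v, Real.negMulLog (q v) := by
    rw [Finset.sum_comm]
    have h : ∀ v, ∑ u, Real.negMulLog (q (u + v) * q' v) = ∑ u, Real.negMulLog (q u * q' v) :=
      fun v => sum_add_right_f2Vec (fun x => Real.negMulLog (q x * q' v)) v
    simp only [h]
    simp only [Real.negMulLog_mul, Finset.sum_add_distrib, ← Finset.mul_sum, ← Finset.sum_mul]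
    ring
  simp only [weightEnt, Finset.sum_sub_distrib, sum_convWeight]
  have h2 : ∑ u, Real.negMulLog (∑ v, q (u + v) * q' v)
      = ∑ u, Real.negMulLog (convWeight q q' u) := rfl
  rw [h1, h2, Real.negMulLog_mul]
  ring

lemma sum_zmod_two (f : ZMod 2 → ℝ) : ∑ x, f x = f 0 + f 1 := Fin.sum_univ_two f

lemma pushWeight_dotProduct (q : F2Vec m → ℝ) (a : F2Vec m) :
    pushWeight (fun v => a ⬝ᵥ v) q = funcWeight q a := by
  funext i
  rw [pushWeight, funcWeight, Finset.sum_filter]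
  exact Finset.sum_congr rfl fun v _ => by congr

lemma le_weightEnt_funcWeight (hq : ∀ v, 0 ≤ q v) (a : F2Vec m) :
    Real.log 2 * (∑ v, q v) - |f2Fourier q a| ≤ weightEnt (funcWeight q a) := by
  have n0 := funcWeight_nonneg hq a 0
  have n1 := funcWeight_nonneg hq a 1
  have hs := funcWeight_zero_add_one q a
  have hd := funcWeight_zero_sub_one q a
  have habs := abs_f2Fourier_le hq a
  rw [weightEnt, sum_zmod_two, sum_zmod_two, hs]
  set s := ∑ v, q v with hsdef
  set x := funcWeight q a 0
  set y := funcWeight q a 1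
  rcases (add_nonneg n0 n1).eq_or_lt with h | h
  · have : s = 0 := by linarith
    have hx : x = 0 := by linarith
    have hy : y = 0 := by linarith
    rw [this, hx, hy]
    simp
  · have hs0 : 0 < s := by linarith
    have hc : 0 < s / 2 := by linarith
    have t0 := le_negMulLog_of_pos n0 hc
    have t1 := le_negMulLog_of_pos n1 hc
    rw [Real.log_div hs0.ne' two_ne_zero] at t0 t1
    have e : x ^ 2 / (s / 2) + y ^ 2 / (s / 2) ≤ s + |f2Fourier q a| := by
      rw [← add_div, div_le_iff₀ hc]
      have h2 : f2Fourier q a ^ 2 = |f2Fourier q a| * |f2Fourier q a| := by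
        rw [← sq, sq_abs]
      have h3 : |f2Fourier q a| * |f2Fourier q a| ≤ s * |f2Fourier q a| :=
        mul_le_mul_of_nonneg_right habs (abs_nonneg _)
      have h4 : 2 * (x ^ 2 + y ^ 2) = s ^ 2 + f2Fourier q a ^ 2 := by rw [← hs, ← hd]; ring
      nlinarith
    have e2 : x * (Real.log s - Real.log 2) + y * (Real.log s - Real.log 2)
        = s * Real.log s - s * Real.log 2 := by rw [← hs]; ring
    rw [show Real.negMulLog s = -(s * Real.log s) by rw [Real.negMulLog]; ring]
    linarith

lemma le_weightEnt_pushWeight_mulVec (hq : ∀ v, 0 ≤ q v) {l : ℕ}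
    (A : Matrix (Fin l) (Fin m) (ZMod 2)) (i : Fin l) :
    Real.log 2 * (∑ v, q v) - |f2Fourier q (A i)| ≤ weightEnt (pushWeight A.mulVec q) := by
  refine (le_weightEnt_funcWeight hq (A i)).trans ?_
  rw [← pushWeight_dotProduct,
    show (fun v => A i ⬝ᵥ v) = (fun y : Fin l → ZMod 2 => y i) ∘ A.mulVec from rfl,
    ← pushWeight_comp]
  exact weightEnt_pushWeight_le _ (pushWeight_nonneg _ hq)

lemma weightEnt_pushWeight_mulVec_le (hq : ∀ v, 0 ≤ q v) {l : ℕ}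
    (A : Matrix (Fin l) (Fin m) (ZMod 2)) {c : ℝ} (hc : 0 ≤ c) (h : ∀ i, bhatt q (A i) ≤ c) :
    weightEnt (pushWeight A.mulVec q) ≤ (2 ^ l) ^ 2 * c := by
  have key : ∀ y y' : Fin l → ZMod 2, y ≠ y' →
      Real.sqrt (pushWeight A.mulVec q y * pushWeight A.mulVec q y') ≤ c / 2 := by
    intro y y' hy
    obtain ⟨i, hi⟩ := Function.ne_iff.1 hy
    have hle : ∀ y, pushWeight A.mulVec q y ≤ funcWeight q (A i) (y i) := by
      intro y
      rw [← pushWeight_dotProduct]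
      refine Finset.sum_le_sum_of_subset_of_nonneg (fun v hv => ?_) fun v _ _ => hq v
      simp only [Finset.mem_filter, Finset.mem_univ, true_and] at hv ⊢
      exact congrFun hv i
    have hprod : funcWeight q (A i) (y i) * funcWeight q (A i) (y' i)
        = funcWeight q (A i) 0 * funcWeight q (A i) 1 := by
      rcases f2_cases (y i) with h1 | h1 <;> rcases f2_cases (y' i) with h2 | h2 <;>
        rw [h1, h2] at hi ⊢ <;> first | exact absurd rfl hi | ring
    have hb := h i
    rw [bhatt_eq] at hb
    have : Real.sqrt (pushWeight A.mulVec q y * pushWeight A.mulVec q y')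
        ≤ Real.sqrt (funcWeight q (A i) 0 * funcWeight q (A i) 1) := by
      rw [← hprod]
      exact Real.sqrt_le_sqrt (mul_le_mul (hle y) (hle y') (pushWeight_nonneg _ hq _)
        (funcWeight_nonneg hq _ _))
    linarith
  refine (weightEnt_le_of_sqrt_mul_le (pushWeight_nonneg _ hq) (by linarith) key).trans
    (le_of_eq ?_)
  simp [ZMod.card]
  ring

lemma finrank_f2Vec : Module.finrank (ZMod 2) (F2Vec m) = m := by simp

lemma card_submodule_f2Vec (K : Submodule (ZMod 2) (F2Vec m)) :
    Fintype.card K = 2 ^ Module.finrank (ZMod 2) K := by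
  rw [Module.card_eq_pow_finrank (K := ZMod 2), ZMod.card]

lemma card_mulVec_fiber_le {l : ℕ} (A : Matrix (Fin l) (Fin m) (ZMod 2)) (y : Fin l → ZMod 2) :
    (Finset.univ.filter fun x => A.mulVec x = y).card ≤ 2 ^ (m - A.rank) := by
  have hker : Fintype.card (LinearMap.ker A.mulVecLin) = 2 ^ (m - A.rank) := by
    rw [card_submodule_f2Vec]
    congr 1
    have h : A.rank + Module.finrank (ZMod 2) (LinearMap.ker A.mulVecLin) = m :=
      (LinearMap.finrank_range_add_finrank_ker A.mulVecLin).trans finrank_f2Vec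
    exact Nat.eq_sub_of_add_eq' h
  rcases (Finset.univ.filter fun x => A.mulVec x = y).eq_empty_or_nonempty with h | ⟨x₀, h₀⟩
  · rw [h]; simp
  · rw [← hker, ← Finset.card_univ]
    have h₀' := (Finset.mem_filter.1 h₀).2
    refine Finset.card_le_card_of_injOn
      (fun x => if hx : A.mulVec x = y then
        ⟨x + x₀, by
          rw [LinearMap.mem_ker, Matrix.mulVecLin_apply, Matrix.mulVec_add, hx, h₀']
          exact f2Vec_add_self y⟩ else 0) (fun _ _ => Finset.mem_coe.2 (Finset.mem_univ _)) ?_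
    intro x hx x' hx' hxx
    have hx1 := (Finset.mem_filter.1 (Finset.mem_coe.1 hx)).2
    have hx2 := (Finset.mem_filter.1 (Finset.mem_coe.1 hx')).2
    simp only [hx1, hx2, dif_pos, Subtype.mk.injEq, add_left_inj] at hxx
    exact hxx

lemma rank_le_of_cols {l : ℕ} (A : Matrix (Fin l) (Fin m) (ZMod 2)) : A.rank ≤ m := by
  simpa using A.rank_le_card_width

lemma weightEnt_le_pushWeight_mulVec (hq : ∀ v, 0 ≤ q v) {l : ℕ}
    (A : Matrix (Fin l) (Fin m) (ZMod 2)) :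
    weightEnt q ≤ weightEnt (pushWeight A.mulVec q)
      + (∑ v, q v) * (((m : ℝ) - A.rank) * Real.log 2) := by
  refine (weightEnt_le_pushWeight_add A.mulVec hq (N := 2 ^ (m - A.rank)) fun y => ?_).trans
    (le_of_eq ?_)
  · convert card_mulVec_fiber_le A y
  push_cast
  rw [Real.log_pow, Nat.cast_sub (rank_le_of_cols A)]

/-- Lower bound on the entropy by the Fourier mass outside a subspace of functionals. -/
lemma le_weightEnt_of_submodule (hq : ∀ v, 0 ≤ q v) (K : Submodule (ZMod 2) (F2Vec m)) :
    (∑ v, q v) * (((m : ℝ) - Module.finrank (ZMod 2) K) * Real.log 2)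
      - ∑ a with a ∉ K, |f2Fourier q a| ≤ weightEnt q := by
  set s := ∑ v, q v with hs
  set r := Module.finrank (ZMod 2) K with hr
  set T := ∑ a with a ∉ K, |f2Fourier q a| with hT
  have hT0 : 0 ≤ T := Finset.sum_nonneg fun _ _ => abs_nonneg _
  have hs0 : 0 ≤ s := Finset.sum_nonneg fun v _ => hq v
  rcases hs0.eq_or_lt with h | h
  · rw [← h, zero_mul]
    linarith [weightEnt_nonneg hq]
  · set c := s * 2 ^ r / 2 ^ m with hc
    have hc0 : 0 < c := by positivity
    have hlogc : Real.log c = Real.log s + r * Real.log 2 - m * Real.log 2 := by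
      rw [hc, Real.log_div (by positivity) (by positivity), Real.log_mul h.ne' (by positivity),
        Real.log_pow, Real.log_pow]
    have h1 := Finset.sum_le_sum fun x (_ : x ∈ Finset.univ) => le_negMulLog_of_pos (hq x) hc0
    rw [Finset.sum_sub_distrib, Finset.sum_sub_distrib, ← Finset.sum_mul, ← Finset.sum_div,
      ← hs] at h1
    have hsq : ∑ x, q x ^ 2 ≤ (s + T) * c := by
      have hF : ∑ a, f2Fourier q a ^ 2 ≤ 2 ^ r * s ^ 2 + s * T := by
        rw [← Finset.sum_filter_add_sum_filter_not Finset.univ (fun a => a ∈ K)]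
        refine add_le_add ?_ ?_
        · refine (Finset.sum_le_card_nsmul _ _ _ fun a _ => f2Fourier_sq_le hq a).trans
            (le_of_eq ?_)
          rw [nsmul_eq_mul, ← Fintype.card_subtype]
          congr 1
          have := card_submodule_f2Vec K
          rw [← hr] at this
          exact_mod_cast this
        · rw [hT, Finset.mul_sum]
          refine Finset.sum_le_sum fun a _ => ?_
          rw [← sq_abs, sq]
          exact mul_le_mul_of_nonneg_right (abs_f2Fourier_le hq a) (abs_nonneg _)
      rw [sum_f2Fourier_sq] at hF
      have h2r : (1 : ℝ) ≤ 2 ^ r := one_le_pow₀ (by norm_num)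
      have hsT : s * T ≤ 2 ^ r * (s * T) := le_mul_of_one_le_left (by positivity) h2r
      rw [hc, mul_div_assoc', le_div_iff₀ (by positivity)]
      nlinarith
    have h2 : (∑ x, q x ^ 2) / c ≤ s + T := (div_le_iff₀ hc0).2 hsq
    rw [hlogc] at h1
    rw [weightEnt, ← hs, show Real.negMulLog s = -(s * Real.log s) by rw [Real.negMulLog]; ring]
    nlinarith

/-- Every subspace of functionals is the row space of a matrix with not too many rows. -/
lemma exists_matrix_rows (K : Submodule (ZMod 2) (F2Vec m)) :
    ∃ (l : ℕ) (A : Matrix (Fin l) (Fin m) (ZMod 2)), l ≤ 2 ^ m ∧ (∀ i, A i ∈ K) ∧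
      A.rank = Module.finrank (ZMod 2) K := by
  refine ⟨Fintype.card K, Matrix.of fun i => ((Fintype.equivFin K).symm i : F2Vec m), ?_,
    fun i => ((Fintype.equivFin K).symm i).2, ?_⟩
  · rw [card_submodule_f2Vec]
    refine Nat.pow_le_pow_right (by norm_num) ?_
    simpa using K.finrank_le
  · have : Set.range (Matrix.of fun i => ((Fintype.equivFin K).symm i : F2Vec m)).row
        = (K : Set (F2Vec m)) := by
      ext x
      constructor
      · rintro ⟨i, rfl⟩
        exact ((Fintype.equivFin K).symm i).2
      · intro hx
        exact ⟨Fintype.equivFin K ⟨x, hx⟩, by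
          change (((Fintype.equivFin K).symm (Fintype.equivFin K ⟨x, hx⟩) : K) : F2Vec m) = x
          rw [Equiv.symm_apply_apply]⟩
    rw [Matrix.rank_eq_finrank_span_row, this, Submodule.span_eq]

lemma rank_le_finrank_of_rows_mem {l : ℕ} {A : Matrix (Fin l) (Fin m) (ZMod 2)}
    {K : Submodule (ZMod 2) (F2Vec m)} (h : ∀ i, A i ∈ K) :
    A.rank ≤ Module.finrank (ZMod 2) K := by
  rw [Matrix.rank_eq_finrank_span_row]
  refine Submodule.finrank_mono (Submodule.span_le.2 ?_)
  rintro _ ⟨i, rfl⟩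
  exact h i

end LinearImages

/-! ### Vector sources with side information and their polarization -/

/-- Joint law of a random vector of `F₂^m` and of side information in a finite set. -/
structure F2Source (m : ℕ) where
  /-- values of the side information -/
  Idx : Type
  [fin : Fintype Idx]
  /-- joint weights -/
  wt : Idx → F2Vec m → ℝ
  nonneg : ∀ e v, 0 ≤ wt e v
  sum_eq_one : ∑ e, ∑ v, wt e v = 1

attribute [instance] F2Source.fin

namespace F2Source

variable {m : ℕ} (S : F2Source m)

/-- Sum over the side information of a functional of the joint weights. -/
noncomputable def total (Φ : (F2Vec m → ℝ) → ℝ) : ℝ := ∑ e, Φ (S.wt e)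

lemma total_mul_total (Φ Ψ : (F2Vec m → ℝ) → ℝ) :
    S.total Φ * S.total Ψ = ∑ e, ∑ e', Φ (S.wt e) * Ψ (S.wt e') := Finset.sum_mul_sum _ _ _ _

lemma total_sum : S.total (fun q => ∑ v, q v) = 1 := S.sum_eq_one

lemma total_nonneg {Φ : (F2Vec m → ℝ) → ℝ} (h : ∀ q, (∀ v, 0 ≤ q v) → 0 ≤ Φ q) :
    0 ≤ S.total Φ := Finset.sum_nonneg fun e _ => h _ (S.nonneg e)

lemma total_le_total {Φ Ψ : (F2Vec m → ℝ) → ℝ} (h : ∀ q, (∀ v, 0 ≤ q v) → Φ q ≤ Ψ q) :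
    S.total Φ ≤ S.total Ψ := Finset.sum_le_sum fun e _ => h _ (S.nonneg e)

/-- The sum of two independent copies. -/
noncomputable def minus : F2Source m where
  Idx := S.Idx × S.Idx
  wt e := convWeight (S.wt e.1) (S.wt e.2)
  nonneg e := convWeight_nonneg (S.nonneg _) (S.nonneg _)
  sum_eq_one := by
    simp only [sum_convWeight, Fintype.sum_prod_type, ← Finset.mul_sum, ← Finset.sum_mul]
    rw [S.sum_eq_one, one_mul]

/-- The second of two independent copies, given their sum. -/
noncomputable def plus : F2Source m where
  Idx := F2Vec m × S.Idx × S.Idx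
  wt e v := S.wt e.2.1 (e.1 + v) * S.wt e.2.2 v
  nonneg e v := mul_nonneg (S.nonneg _ _) (S.nonneg _ _)
  sum_eq_one := by
    rw [Fintype.sum_prod_type, Finset.sum_comm, Fintype.sum_prod_type]
    have : ∀ e e', ∑ u, ∑ v, S.wt e (u + v) * S.wt e' v = (∑ v, S.wt e v) * ∑ v, S.wt e' v :=
      fun e e' => sum_convWeight (S.wt e) (S.wt e')
    simp only [this, ← Finset.mul_sum, ← Finset.sum_mul]
    rw [S.sum_eq_one, one_mul]

lemma total_minus (Φ : (F2Vec m → ℝ) → ℝ) :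
    S.minus.total Φ = ∑ e, ∑ e', Φ (convWeight (S.wt e) (S.wt e')) := Fintype.sum_prod_type _

lemma total_plus (Φ : (F2Vec m → ℝ) → ℝ) :
    S.plus.total Φ = ∑ e, ∑ e', ∑ u, Φ (fun v => S.wt e (u + v) * S.wt e' v) := by
  refine (Fintype.sum_prod_type (f := fun i : F2Vec m × S.Idx × S.Idx => Φ (S.plus.wt i))).trans ?_
  rw [Finset.sum_comm, Fintype.sum_prod_type]
  rfl

/-- Conditional entropy (in nats) of the vector given the side information. -/
noncomputable def ent : ℝ := S.total weightEnt

/-- Conditional entropy (in nats) of a linear image given the side information. -/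
noncomputable def linEnt {l : ℕ} (A : Matrix (Fin l) (Fin m) (ZMod 2)) : ℝ :=
  S.total fun q => weightEnt (pushWeight A.mulVec q)

/-- Bhattacharyya parameter of the linear functional `a`. -/
noncomputable def bh (a : F2Vec m) : ℝ := S.total fun q => bhatt q a

/-- Total Fourier mass at `a`. -/
noncomputable def fo (a : F2Vec m) : ℝ := S.total fun q => |f2Fourier q a|

lemma ent_step : (S.minus.ent + S.plus.ent) / 2 = S.ent := by
  have h : S.minus.ent + S.plus.ent = S.ent + S.ent := by
    simp only [ent, total_minus, total_plus, ← Finset.sum_add_distrib, weightEnt_convWeight_add]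
    simp only [Finset.sum_add_distrib]
    have h1 := S.total_mul_total (fun q => ∑ v, q v) weightEnt
    have h2 := S.total_mul_total weightEnt (fun q => ∑ v, q v)
    rw [total_sum, one_mul] at h1
    rw [total_sum, mul_one] at h2
    rw [← h1]
    congr 1
    rw [h2]
    exact Finset.sum_congr rfl fun e _ => Finset.sum_congr rfl fun e' _ => mul_comm _ _
  linarith

lemma bh_nonneg (a : F2Vec m) : 0 ≤ S.bh a := S.total_nonneg fun q _ => bhatt_nonneg q a

lemma fo_nonneg (a : F2Vec m) : 0 ≤ S.fo a := S.total_nonneg fun _ _ => abs_nonneg _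

lemma bh_le_one (a : F2Vec m) : S.bh a ≤ 1 :=
  (S.total_le_total fun _ hq => bhatt_le_sum hq a).trans_eq S.total_sum

lemma fo_le_one (a : F2Vec m) : S.fo a ≤ 1 :=
  (S.total_le_total fun _ hq => abs_f2Fourier_le hq a).trans_eq S.total_sum

lemma bh_zero : S.bh 0 = 0 := by simp [bh, total, bhatt_zero]

lemma bh_add_le (a b : F2Vec m) : S.bh (a + b) ≤ S.bh a + S.bh b := by
  rw [bh, bh, bh, total, total, total, ← Finset.sum_add_distrib]
  exact Finset.sum_le_sum fun e _ => bhatt_add_le (S.nonneg e) a b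

lemma bh_plus_le (a : F2Vec m) : S.plus.bh a ≤ S.bh a ^ 2 := by
  rw [sq, bh, bh, total_plus, total_mul_total]
  exact Finset.sum_le_sum fun e _ => Finset.sum_le_sum fun e' _ =>
    sum_bhatt_shift_le (S.nonneg e) (S.nonneg e') a

lemma le_bh_minus (a : F2Vec m) : S.bh a ≤ S.minus.bh a := by
  have h := S.total_mul_total (fun q => ∑ v, q v) (fun q => bhatt q a)
  rw [total_sum, one_mul] at h
  rw [bh, bh, total_minus, h]
  exact Finset.sum_le_sum fun e _ => Finset.sum_le_sum fun e' _ =>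
    le_bhatt_convWeight (S.nonneg e) (S.nonneg e') a

lemma bh_minus_le (a : F2Vec m) : S.minus.bh a ≤ 2 * S.bh a - S.bh a ^ 2 := by
  have h1 := S.total_mul_total (fun q => ∑ v, q v) (fun q => bhatt q a)
  have h2 := S.total_mul_total (fun q => bhatt q a) (fun q => ∑ v, q v)
  have h3 := S.total_mul_total (fun q => bhatt q a) (fun q => bhatt q a)
  rw [total_sum, one_mul] at h1
  rw [total_sum, mul_one] at h2
  have : 2 * S.bh a - S.bh a ^ 2 = S.total (fun q => bhatt q a) + S.total (fun q => bhatt q a)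
      - S.total (fun q => bhatt q a) * S.total (fun q => bhatt q a) := by
    rw [bh]; ring
  rw [this, h3]
  nth_rewrite 1 [h1]
  rw [h2]
  simp only [bh, total_minus, ← Finset.sum_add_distrib, ← Finset.sum_sub_distrib]
  refine Finset.sum_le_sum fun e _ => Finset.sum_le_sum fun e' _ => ?_
  have := bhatt_convWeight_le (S.nonneg e) (S.nonneg e') a
  linarith

lemma fo_minus (a : F2Vec m) : S.minus.fo a = S.fo a ^ 2 := by
  rw [sq, fo, fo, total_minus, total_mul_total]
  simp only [f2Fourier_convWeight, abs_mul]

lemma fo_plus_le (a : F2Vec m) : S.plus.fo a ≤ ∑ c, S.fo c * S.fo (a + c) := by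
  simp only [fo, total_plus, total_mul_total]
  refine (Finset.sum_le_sum fun e _ => Finset.sum_le_sum fun e' _ =>
    sum_abs_f2Fourier_shift_le (S.wt e) (S.wt e') a).trans_eq ?_
  rw [Finset.sum_comm (s := (Finset.univ : Finset (F2Vec m)))]
  exact Finset.sum_congr rfl fun e _ => Finset.sum_comm

lemma fo_sq_add_bh_sq_le (a : F2Vec m) : S.fo a ^ 2 + S.bh a ^ 2 ≤ 1 := by
  have h := Finset.sum_sq_le_sum_mul_sum_of_sq_le_mul Finset.univ
    (r := fun e => |f2Fourier (S.wt e) a|) (f := fun e => ∑ v, S.wt e v - bhatt (S.wt e) a)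
    (g := fun e => ∑ v, S.wt e v + bhatt (S.wt e) a)
    (fun e _ => sub_nonneg.2 (bhatt_le_sum (S.nonneg e) a))
    (fun e _ => add_nonneg (Finset.sum_nonneg fun v _ => S.nonneg e v) (bhatt_nonneg _ _))
    (fun e _ => by
      have := bhatt_sq (S.nonneg e) a
      rw [sq_abs]
      linarith)
  rw [Finset.sum_sub_distrib, Finset.sum_add_distrib, S.sum_eq_one] at h
  change S.fo a ^ 2 ≤ (1 - S.bh a) * (1 + S.bh a) at h
  linarith

lemma le_linEnt {l : ℕ} (A : Matrix (Fin l) (Fin m) (ZMod 2)) (i : Fin l) :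
    Real.log 2 - S.fo (A i) ≤ S.linEnt A := by
  have h := S.total_le_total fun q hq => le_weightEnt_pushWeight_mulVec hq A i
  refine le_trans (le_of_eq ?_) h
  rw [total, Finset.sum_sub_distrib, ← Finset.mul_sum, S.sum_eq_one, mul_one]
  rfl

lemma ent_le_linEnt_add {l : ℕ} (A : Matrix (Fin l) (Fin m) (ZMod 2)) :
    S.ent ≤ S.linEnt A + ((m : ℝ) - A.rank) * Real.log 2 := by
  refine (S.total_le_total fun q hq => weightEnt_le_pushWeight_mulVec hq A).trans (le_of_eq ?_)
  rw [total, Finset.sum_add_distrib, ← Finset.sum_mul, S.sum_eq_one, one_mul]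
  rfl

lemma ent_nonneg : 0 ≤ S.ent := S.total_nonneg fun _ hq => weightEnt_nonneg hq

lemma ent_le : S.ent ≤ m * Real.log 2 := by
  refine (S.total_le_total fun q hq => weightEnt_le_log_card hq).trans (le_of_eq ?_)
  rw [total, ← Finset.sum_mul, S.sum_eq_one, one_mul]
  simp [ZMod.card]

section Subspace

variable (K : Submodule (ZMod 2) (F2Vec m))

/-- Sum of the Bhattacharyya parameters over a subspace of functionals. -/
noncomputable def bhOn : ℝ := ∑ a with a ∈ K, S.bh a

/-- Fourier mass outside a subspace of functionals. -/
noncomputable def foOff : ℝ := ∑ a with a ∉ K, S.fo a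

lemma bhOn_nonneg : 0 ≤ S.bhOn K := Finset.sum_nonneg fun a _ => S.bh_nonneg a

lemma foOff_nonneg : 0 ≤ S.foOff K := Finset.sum_nonneg fun a _ => S.fo_nonneg a

lemma bhOn_plus_le : S.plus.bhOn K ≤ S.bhOn K ^ 2 := by
  refine (Finset.sum_le_sum fun a _ => S.bh_plus_le a).trans ?_
  rw [sq, bhOn, Finset.sum_mul]
  refine Finset.sum_le_sum fun a ha => ?_
  rw [sq]
  exact mul_le_mul_of_nonneg_left
    (Finset.single_le_sum (f := S.bh) (fun b _ => S.bh_nonneg b) ha) (S.bh_nonneg a)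

lemma bhOn_minus_le : S.minus.bhOn K ≤ 2 ^ (m + 1) * S.bhOn K := by
  have h : S.minus.bhOn K ≤ 2 * S.bhOn K := by
    rw [bhOn, bhOn, Finset.mul_sum]
    exact Finset.sum_le_sum fun a _ => by nlinarith [S.bh_minus_le a, sq_nonneg (S.bh a)]
  have h2 : (1 : ℝ) ≤ 2 ^ m := one_le_pow₀ (by norm_num)
  rw [pow_succ]
  nlinarith [S.bhOn_nonneg K]

lemma foOff_minus_le : S.minus.foOff K ≤ S.foOff K ^ 2 := by
  rw [foOff, foOff, sq, Finset.sum_mul]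
  refine Finset.sum_le_sum fun a ha => ?_
  rw [fo_minus, sq]
  exact mul_le_mul_of_nonneg_left
    (Finset.single_le_sum (f := S.fo) (fun b _ => S.fo_nonneg b) ha) (S.fo_nonneg a)

lemma foOff_plus_le : S.plus.foOff K ≤ 2 ^ (m + 1) * S.foOff K := by
  have h : ∀ a, a ∉ K → S.plus.fo a ≤ 2 * S.foOff K := by
    intro a ha
    refine (S.fo_plus_le a).trans ?_
    have hsplit : ∀ c, S.fo c * S.fo (a + c)
        ≤ (if c ∉ K then S.fo c else 0) + (if c + a ∉ K then S.fo (c + a) else 0) := by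
      intro c
      rw [add_comm a c]
      have h0 := S.fo_nonneg c
      have h1 := S.fo_nonneg (c + a)
      have h2 := S.fo_le_one c
      have h3 := S.fo_le_one (c + a)
      by_cases hc : c ∈ K
      · have : c + a ∉ K := fun h => ha ((K.add_mem_iff_right hc).1 h)
        rw [if_neg (not_not.2 hc), if_pos this]
        nlinarith
      · rw [if_pos hc]
        have : 0 ≤ if c + a ∉ K then S.fo (c + a) else 0 := by split_ifs <;> simp [h1]
        nlinarith
    refine (Finset.sum_le_sum fun c _ => hsplit c).trans_eq ?_
    rw [Finset.sum_add_distrib, sum_add_right_f2Vec (fun c => if c ∉ K then S.fo c else 0) a,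
      ← Finset.sum_filter, foOff]
    ring
  rw [foOff]
  refine (Finset.sum_le_card_nsmul _ _ _ fun a ha => h a (Finset.mem_filter.1 ha).2).trans ?_
  rw [nsmul_eq_mul, pow_succ, mul_assoc]
  refine mul_le_mul_of_nonneg_right ?_ (by linarith [S.foOff_nonneg K])
  have := Finset.card_filter_le (Finset.univ : Finset (F2Vec m)) (fun a => a ∉ K)
  rw [Finset.card_univ, Fintype.card_fun, ZMod.card, Fintype.card_fin] at this
  exact_mod_cast this

lemma linEnt_le {l : ℕ} (A : Matrix (Fin l) (Fin m) (ZMod 2)) (hA : ∀ i, A i ∈ K) :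
    S.linEnt A ≤ (2 ^ l) ^ 2 * S.bhOn K := by
  have h := S.total_le_total fun q hq => weightEnt_pushWeight_mulVec_le hq A
    (c := ∑ a with a ∈ K, bhatt q a) (Finset.sum_nonneg fun a _ => bhatt_nonneg q a)
    fun i => Finset.single_le_sum (f := fun a => bhatt q a) (fun a _ => bhatt_nonneg q a)
      (Finset.mem_filter.2 ⟨Finset.mem_univ _, hA i⟩)
  refine h.trans_eq ?_
  rw [total, ← Finset.mul_sum, Finset.sum_comm]
  rfl

lemma exists_matrix_linEnt_le : ∃ (l : ℕ) (A : Matrix (Fin l) (Fin m) (ZMod 2)),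
    A.rank = Module.finrank (ZMod 2) K ∧ S.linEnt A ≤ (2 ^ 2 ^ m) ^ 2 * S.bhOn K := by
  obtain ⟨l, A, hl, hA, hr⟩ := exists_matrix_rows K
  refine ⟨l, A, hr, (S.linEnt_le K A hA).trans ?_⟩
  have : (2 : ℝ) ^ l ≤ 2 ^ 2 ^ m := pow_le_pow_right₀ (by norm_num) hl
  exact mul_le_mul_of_nonneg_right (pow_le_pow_left₀ (by positivity) this 2) (S.bhOn_nonneg K)

lemma ent_le_of_submodule :
    S.ent ≤ (2 ^ 2 ^ m) ^ 2 * S.bhOn K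
      + ((m : ℝ) - Module.finrank (ZMod 2) K) * Real.log 2 := by
  obtain ⟨l, A, hr, hA⟩ := S.exists_matrix_linEnt_le K
  have := S.ent_le_linEnt_add A
  rw [hr] at this
  linarith

lemma le_ent_of_submodule :
    ((m : ℝ) - Module.finrank (ZMod 2) K) * Real.log 2 - S.foOff K ≤ S.ent := by
  refine le_trans (le_of_eq ?_) (S.total_le_total fun q hq => le_weightEnt_of_submodule hq K)
  rw [total, Finset.sum_sub_distrib, ← Finset.sum_mul, S.sum_eq_one, one_mul, Finset.sum_comm]
  rfl

end Subspace

/-- Maximal rank of a linear image of conditional entropy (in bits) at most `ε`. -/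
noncomputable def maxRk (ε : ℝ) : ℕ :=
  sSup {r : ℕ | ∃ (l : ℕ) (A : Matrix (Fin l) (Fin m) (ZMod 2)),
    A.rank = r ∧ S.linEnt A / Real.log 2 ≤ ε}

lemma maxRk_le {ε : ℝ} {r : ℕ}
    (h : ∀ (l : ℕ) (A : Matrix (Fin l) (Fin m) (ZMod 2)), S.linEnt A / Real.log 2 ≤ ε → A.rank ≤ r) :
    S.maxRk ε ≤ r :=
  csSup_le' (by rintro _ ⟨l, A, rfl, hA⟩; exact h l A hA)

lemma maxRk_le_dim (ε : ℝ) : S.maxRk ε ≤ m := S.maxRk_le fun _ A _ => rank_le_of_cols A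

lemma le_maxRk_of_submodule (K : Submodule (ZMod 2) (F2Vec m)) {ε : ℝ}
    (h : (2 ^ 2 ^ m) ^ 2 * S.bhOn K / Real.log 2 ≤ ε) : Module.finrank (ZMod 2) K ≤ S.maxRk ε := by
  obtain ⟨l, A, hr, hA⟩ := S.exists_matrix_linEnt_le K
  refine le_csSup ⟨m, ?_⟩ ⟨l, A, hr, le_trans ?_ h⟩
  · rintro _ ⟨l, A, rfl, -⟩
    exact rank_le_of_cols A
  · exact div_le_div_of_nonneg_right hA (Real.log_nonneg one_le_two)

lemma maxRk_le_of_submodule (K : Submodule (ZMod 2) (F2Vec m)) {ε : ℝ}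
    (h : S.foOff K < Real.log 2 * (1 - ε)) : S.maxRk ε ≤ Module.finrank (ZMod 2) K := by
  refine S.maxRk_le fun l A hA => rank_le_finrank_of_rows_mem fun i => ?_
  by_contra hi
  have h1 : S.fo (A i) ≤ S.foOff K := Finset.single_le_sum (f := S.fo) (fun a _ => S.fo_nonneg a)
    (Finset.mem_filter.2 ⟨Finset.mem_univ _, hi⟩)
  have h2 := S.le_linEnt A i
  rw [div_le_iff₀ (Real.log_pos one_lt_two)] at hA
  linarith

end F2Source

/-! ### Fast polarization of the maximal ranks -/

lemma abs_treeAvg_sub_le {S : Type*} {σ τ : S → S} {f g h : S → ℝ} (hfg : ∀ s, |f s - g s| ≤ h s)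
    (k : ℕ) (s : S) : |treeAvg σ τ k f s - treeAvg σ τ k g s| ≤ treeAvg σ τ k h s := by
  induction k generalizing s with
  | zero => exact hfg s
  | succ k ih =>
    simp only [treeAvg]
    have h1 := abs_le.1 (ih (σ s))
    have h2 := abs_le.1 (ih (τ s))
    rw [abs_le]
    constructor <;> linarith [h1.1, h1.2, h2.1, h2.2]

/-- The doubly exponential decay rate `β` eventually beats the threshold with exponent `α < β`. -/
lemma eventually_threshold_le {α β : ℝ} (hβ : 0 < β) (hαβ : α < β) (c : ℝ) (n : ℕ) :
    ∀ᶠ l : ℕ in atTop,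
      c * (2 : ℝ) ^ (-((2 : ℝ) ^ (β * l))) / Real.log 2
          ≤ (2 : ℝ) ^ (-(((2 ^ (n + l) : ℕ) : ℝ) ^ α)) ∧
        (2 : ℝ) ^ (-((2 : ℝ) ^ (β * l)))
          < Real.log 2 * (1 - (2 : ℝ) ^ (-(((2 ^ (n + l) : ℕ) : ℝ) ^ α))) := by
  have hL : 0 < Real.log 2 := Real.log_pos one_lt_two
  have hy : Tendsto (fun l : ℕ => (2 : ℝ) ^ (β * l)) atTop atTop :=
    (tendsto_rpow_atTop_of_base_gt_one 2 one_lt_two).comp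
      (tendsto_natCast_atTop_atTop.const_mul_atTop hβ)
  have hpow : ∀ l : ℕ, (((2 ^ (n + l) : ℕ) : ℝ) ^ α) = (2 : ℝ) ^ (α * n) * (2 : ℝ) ^ (α * l) := by
    intro l
    rw [← Real.rpow_add two_pos, Nat.cast_pow, Nat.cast_ofNat, ← Real.rpow_natCast,
      ← Real.rpow_mul zero_le_two]
    congr 1
    push_cast
    ring
  have hxy : Tendsto (fun l : ℕ => (2 : ℝ) ^ (α * n) * (2 : ℝ) ^ ((α - β) * l)) atTop (nhds 0) := by
    rw [← mul_zero ((2 : ℝ) ^ (α * n))]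
    refine Tendsto.const_mul _ ((tendsto_rpow_atBot_of_base_gt_one 2 one_lt_two).comp ?_)
    exact tendsto_natCast_atTop_atTop.const_mul_atTop_of_neg (by linarith)
  have hsmall : Tendsto (fun l : ℕ => c / Real.log 2 *
      Real.exp (-(Real.log 2 / 2) * (2 : ℝ) ^ (β * l))) atTop (nhds 0) := by
    rw [← mul_zero (c / Real.log 2)]
    exact Tendsto.const_mul _ (Real.tendsto_exp_atBot.comp
      (hy.const_mul_atTop_of_neg (by linarith)))
  have hθ : Tendsto (fun l : ℕ => (2 : ℝ) ^ (-(α * n)) *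
      (((2 : ℝ) ^ (β * l)) ^ (-(α / β)) * Real.exp (-Real.log 2 * (2 : ℝ) ^ (β * l)))
      + Real.log 2 * (((2 : ℝ) ^ (β * l)) ^ (0 : ℝ) *
        Real.exp (-Real.log 2 * (2 : ℝ) ^ (β * l)))) atTop (nhds 0) := by
    have h := fun s => (tendsto_rpow_mul_exp_neg_mul_atTop_nhds_zero s (Real.log 2) hL).comp hy
    simpa using ((h (-(α / β))).const_mul ((2 : ℝ) ^ (-(α * n)))).add
      ((h 0).const_mul (Real.log 2))
  filter_upwards [hxy.eventually (gt_mem_nhds (by norm_num : (0 : ℝ) < 1 / 2)),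
    hsmall.eventually (gt_mem_nhds one_pos), hθ.eventually (gt_mem_nhds (pow_pos hL 2))]
    with l h1 h2 h3
  rw [hpow]
  set x := (2 : ℝ) ^ (α * n) * (2 : ℝ) ^ (α * l) with hx
  set y := (2 : ℝ) ^ (β * l) with hydef
  have hx0 : 0 < x := by positivity
  have hy0 : 0 < y := by positivity
  have hxle : x ≤ y / 2 := by
    have : x = (2 : ℝ) ^ (α * n) * (2 : ℝ) ^ ((α - β) * l) * y := by
      have h : (2 : ℝ) ^ (α * l) = (2 : ℝ) ^ ((α - β) * l) * (2 : ℝ) ^ (β * l) := by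
        rw [← Real.rpow_add two_pos]
        ring_nf
      rw [hx, hydef, h, mul_assoc]
    rw [this]
    nlinarith
  have hexp : ∀ t : ℝ, (2 : ℝ) ^ t = Real.exp (Real.log 2 * t) := fun t =>
    Real.rpow_def_of_pos two_pos t
  constructor
  · have e1 : (2 : ℝ) ^ (-y) = Real.exp (-(Real.log 2 / 2) * y) * Real.exp (-(Real.log 2 / 2) * y) := by
      rw [hexp, ← Real.exp_add]
      congr 1
      ring
    have e2 : Real.exp (-(Real.log 2 / 2) * y) ≤ (2 : ℝ) ^ (-x) := by
      rw [hexp]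
      exact Real.exp_le_exp.2 (by nlinarith)
    calc c * (2 : ℝ) ^ (-y) / Real.log 2
        = c / Real.log 2 * Real.exp (-(Real.log 2 / 2) * y)
          * Real.exp (-(Real.log 2 / 2) * y) := by rw [e1]; ring
      _ ≤ 1 * Real.exp (-(Real.log 2 / 2) * y) :=
          mul_le_mul_of_nonneg_right h2.le (Real.exp_nonneg _)
      _ ≤ (2 : ℝ) ^ (-x) := by rw [one_mul]; exact e2
  · have hyx : (2 : ℝ) ^ (-(α * n)) * y ^ (-(α / β)) = x⁻¹ := by
      rw [hx, hydef, mul_inv, ← Real.rpow_neg two_pos.le, ← Real.rpow_neg two_pos.le,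
        ← Real.rpow_mul two_pos.le]
      congr 2
      field_simp
    rw [Real.rpow_zero, one_mul, ← mul_assoc, hyx] at h3
    have e3 : (2 : ℝ) ^ (-y) = Real.exp (-Real.log 2 * y) := by
      rw [hexp]
      congr 1
      ring
    rw [← e3] at h3
    have e4 : (2 : ℝ) ^ (-x) ≤ (1 + Real.log 2 * x)⁻¹ := by
      rw [Real.rpow_neg two_pos.le, hexp]
      refine inv_anti₀ (by positivity) ?_
      linarith [Real.add_one_le_exp (Real.log 2 * x)]
    have e5 : Real.log 2 * (1 - (1 + Real.log 2 * x)⁻¹)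
        = Real.log 2 ^ 2 * x / (1 + Real.log 2 * x) := by
      have : 1 + Real.log 2 * x ≠ 0 := by positivity
      field_simp
      ring
    refine lt_of_lt_of_le ?_ (mul_le_mul_of_nonneg_left (sub_le_sub_left e4 1) hL.le)
    rw [e5, lt_div_iff₀ (by positivity)]
    have := mul_lt_mul_of_pos_right h3 hx0
    rw [add_mul, mul_assoc, mul_comm ((2 : ℝ) ^ (-y)) x, ← mul_assoc, inv_mul_cancel₀ hx0.ne'] at this
    nlinarith

namespace F2Source

variable {m : ℕ}

lemma abs_maxRk_sub_finrank_le (S : F2Source m) (K : Submodule (ZMod 2) (F2Vec m)) {θ ε : ℝ}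
    (h1 : (2 ^ 2 ^ m) ^ 2 * θ / Real.log 2 ≤ ε) (h2 : θ < Real.log 2 * (1 - ε)) :
    |((m : ℝ) - S.maxRk ε) - ((m : ℝ) - Module.finrank (ZMod 2) K)|
      ≤ m * ((if θ < S.bhOn K then 1 else 0) + if θ < S.foOff K then 1 else 0) := by
  have hr : Module.finrank (ZMod 2) K ≤ m := by simpa using K.finrank_le
  have hr' := S.maxRk_le_dim ε
  have hr0 : (Module.finrank (ZMod 2) K : ℝ) ≤ m := by exact_mod_cast hr
  have hr1 : (S.maxRk ε : ℝ) ≤ m := by exact_mod_cast hr'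
  have hm : (0 : ℝ) ≤ m := Nat.cast_nonneg m
  have hf : (0 : ℝ) ≤ Module.finrank (ZMod 2) K := Nat.cast_nonneg _
  have hg : (0 : ℝ) ≤ S.maxRk ε := Nat.cast_nonneg _
  by_cases c1 : θ < S.bhOn K
  · rw [if_pos c1, abs_le]
    constructor <;> split_ifs <;> linarith
  by_cases c2 : θ < S.foOff K
  · rw [if_pos c2, abs_le]
    constructor <;> split_ifs <;> linarith
  rw [if_neg c1, if_neg c2]
  rw [not_lt] at c1 c2
  have e1 := S.le_maxRk_of_submodule K (ε := ε) (le_trans (by gcongr) h1)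
  have e2 := S.maxRk_le_of_submodule K (c2.trans_lt h2)
  rw [le_antisymm e1 e2]
  simp

lemma exists_abs_treeAvg_maxRk_sub_ent_le {β η : ℝ} (hβ0 : 0 < β) (hβ : β < 1 / 2) (hη : 0 < η) :
    ∃ δ : ℝ, 0 < δ ∧ ∃ N : ℕ, ∀ (W : F2Source m) (K : Submodule (ZMod 2) (F2Vec m)),
      W.bhOn K ≤ δ → W.foOff K ≤ δ → ∀ k, N ≤ k → ∀ ε : ℝ,
      (2 ^ 2 ^ m) ^ 2 * (2 : ℝ) ^ (-((2 : ℝ) ^ (β * k))) / Real.log 2 ≤ ε →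
      (2 : ℝ) ^ (-((2 : ℝ) ^ (β * k))) < Real.log 2 * (1 - ε) →
      |treeAvg minus plus k (fun S => (m : ℝ) - S.maxRk ε) W - W.ent / Real.log 2| ≤ η := by
  have hL : 0 < Real.log 2 := Real.log_pos one_lt_two
  have hC : (2 : ℝ) ≤ 2 ^ (m + 1) := by
    rw [pow_succ]
    linarith [one_le_pow₀ (one_le_two : (1 : ℝ) ≤ 2) (n := m)]
  have hη' : 0 < η / (4 * (m + 1)) := by positivity
  obtain ⟨δ, hδ, N, hN⟩ := exists_treeAvg_exceed_le hC hβ0 hβ hη'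
  set c : ℝ := (2 ^ 2 ^ m) ^ 2 with hc
  have hc1 : 1 ≤ c := one_le_pow₀ (one_le_pow₀ one_le_two)
  have hc0 : 0 < c := by linarith
  refine ⟨min δ (Real.log 2 * η / (2 * c)), by positivity, N, fun W K hb hf k hk ε h1 h2 => ?_⟩
  set r : ℝ := (m : ℝ) - Module.finrank (ZMod 2) K with hr
  have hA : |treeAvg minus plus k (fun S => (m : ℝ) - S.maxRk ε) W - r| ≤ η / 2 := by
    have h := abs_treeAvg_sub_le (σ := minus) (τ := plus)
      (fun S : F2Source m => S.abs_maxRk_sub_finrank_le K h1 h2) k W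
    rw [treeAvg_const, treeAvg_const_mul, treeAvg_add] at h
    refine h.trans ?_
    have t1 := hN plus minus (fun S => S.bhOn K) (fun S => S.bhOn_nonneg K)
      (fun S => S.bhOn_plus_le K) (fun S => S.bhOn_minus_le K) W (hb.trans (min_le_left _ _)) k hk
    have t2 := hN minus plus (fun S => S.foOff K) (fun S => S.foOff_nonneg K)
      (fun S => S.foOff_minus_le K) (fun S => S.foOff_plus_le K) W (hf.trans (min_le_left _ _)) k hk
    rw [treeAvg_comm] at t1
    calc (m : ℝ) * _ ≤ (m : ℝ) * (η / (4 * (m + 1)) + η / (4 * (m + 1))) :=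
          mul_le_mul_of_nonneg_left (add_le_add t1 t2) (Nat.cast_nonneg m)
      _ ≤ ((m : ℝ) + 1) * (η / (4 * (m + 1)) + η / (4 * (m + 1))) :=
          mul_le_mul_of_nonneg_right (by linarith) (by positivity)
      _ = η / 2 := by field_simp; ring
  have hB : |r - W.ent / Real.log 2| ≤ η / 2 := by
    have e1 := W.ent_le_of_submodule K
    have e2 := W.le_ent_of_submodule K
    rw [← hr] at e1 e2
    have b1 : c * W.bhOn K ≤ Real.log 2 * η / 2 := by
      have := mul_le_mul_of_nonneg_left (hb.trans (min_le_right _ _)) hc0.le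
      refine this.trans_eq ?_
      field_simp
    have b2 : W.foOff K ≤ Real.log 2 * η / 2 := by
      refine (hf.trans (min_le_right _ _)).trans ?_
      rw [div_le_div_iff₀ (by positivity) two_pos]
      have : 0 < Real.log 2 * η := by positivity
      nlinarith
    rw [abs_le]
    constructor
    · have : W.ent / Real.log 2 ≤ r + η / 2 := by
        rw [div_le_iff₀ hL]
        nlinarith
      linarith
    · have : r - η / 2 ≤ W.ent / Real.log 2 := by
        rw [le_div_iff₀ hL]
        nlinarith
      linarith
  have := abs_sub_le (treeAvg minus plus k (fun S => (m : ℝ) - S.maxRk ε) W) r (W.ent / Real.log 2)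
  linarith

/-- If every functional is polarized, the nearly deterministic ones form a subspace. -/
lemma exists_submodule_of_polarized (S : F2Source m) {d δ : ℝ} (hd0 : 0 < d) (hd : d ≤ 1 / 4)
    (h1 : 2 ^ m * d ≤ δ) (h2 : (2 ^ m) ^ 2 * (2 * d) ≤ δ ^ 2)
    (h : ∀ a, S.bh a * (1 - S.bh a) < d * (1 - d)) :
    ∃ K : Submodule (ZMod 2) (F2Vec m), S.bhOn K ≤ δ ∧ S.foOff K ≤ δ := by
  have hδ : 0 ≤ δ := le_trans (by positivity) h1
  have hdich : ∀ a, S.bh a < d ∨ 1 - d < S.bh a := by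
    intro a
    by_contra! hcon
    nlinarith [h a, mul_nonneg (sub_nonneg.2 hcon.1) (sub_nonneg.2 hcon.2)]
  have hcard : ∀ (p : F2Vec m → Prop) [DecidablePred p], ((Finset.univ.filter p).card : ℝ) ≤ 2 ^ m := by
    intro p _
    have := Finset.card_filter_le (Finset.univ : Finset (F2Vec m)) p
    rw [Finset.card_univ, Fintype.card_fun, ZMod.card, Fintype.card_fin] at this
    exact_mod_cast this
  let K : Submodule (ZMod 2) (F2Vec m) :=
    { carrier := {a | S.bh a < d}
      zero_mem' := by
        change S.bh 0 < d
        rwa [S.bh_zero]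
      add_mem' := by
        intro a b ha hb
        change S.bh a < d at ha
        change S.bh b < d at hb
        change S.bh (a + b) < d
        refine (hdich (a + b)).resolve_right fun hab => ?_
        linarith [S.bh_add_le a b]
      smul_mem' := by
        intro c a ha
        change S.bh (c • a) < d
        rcases f2_cases c with rfl | rfl
        · rwa [zero_smul, S.bh_zero]
        · rwa [one_smul] }
  have hK : ∀ a, a ∈ K ↔ S.bh a < d := fun a => Iff.rfl
  refine ⟨K, ?_, ?_⟩
  · refine (Finset.sum_le_card_nsmul _ _ d fun a ha =>
      ((hK a).1 (Finset.mem_filter.1 ha).2).le).trans (le_trans ?_ h1)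
    rw [nsmul_eq_mul]
    exact mul_le_mul_of_nonneg_right (hcard _) hd0.le
  · have hfo : ∀ a, a ∉ K → S.fo a ≤ δ / 2 ^ m := by
      intro a ha
      have hb := (hdich a).resolve_left ha
      have hs := S.fo_sq_add_bh_sq_le a
      refine abs_le_of_sq_le_sq' ?_ (by positivity) |>.2
      rw [div_pow, le_div_iff₀ (by positivity)]
      have : S.fo a ^ 2 ≤ 2 * d := by nlinarith
      calc S.fo a ^ 2 * (2 ^ m) ^ 2 ≤ 2 * d * (2 ^ m) ^ 2 := by gcongr
        _ ≤ δ ^ 2 := by linarith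
    refine (Finset.sum_le_card_nsmul _ _ (δ / 2 ^ m) fun a ha =>
      hfo a (Finset.mem_filter.1 ha).2).trans ?_
    rw [nsmul_eq_mul]
    refine (mul_le_mul_of_nonneg_right (hcard fun a => a ∉ K) (by positivity)).trans_eq ?_
    field_simp

lemma exists_treeAvg_not_polarized_le (W : F2Source m) {δ η : ℝ} (hδ : 0 < δ) (hη : 0 < η) :
    ∃ n : ℕ, treeAvg minus plus n (fun S : F2Source m =>
      if ∃ K : Submodule (ZMod 2) (F2Vec m), S.bhOn K ≤ δ ∧ S.foOff K ≤ δ then 0 else 1) W ≤ η := by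
  set M : ℝ := 2 ^ m with hM
  have hM1 : 1 ≤ M := one_le_pow₀ one_le_two
  have hM0 : 0 < M := by linarith
  set d := min (1 / 4) (min (δ / M) (δ ^ 2 / (2 * M ^ 2))) with hd
  have hd0 : 0 < d := by positivity
  have hd1 : d ≤ 1 / 4 := min_le_left _ _
  have hd2 : M * d ≤ δ := by
    have := (min_le_right _ _ : d ≤ _).trans (min_le_left _ _)
    rw [le_div_iff₀ hM0] at this
    linarith
  have hd3 : M ^ 2 * (2 * d) ≤ δ ^ 2 := by
    have := (min_le_right _ _ : d ≤ _).trans (min_le_right _ _)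
    rw [le_div_iff₀ (by positivity)] at this
    linarith
  set p := d * (1 - d) with hp
  have hp0 : 0 < p := mul_pos hd0 (by linarith)
  have hlim : Tendsto (fun n => (p ^ 2)⁻¹ * ∑ a : F2Vec m,
      treeAvg minus plus n (fun S : F2Source m => (S.bh a * (1 - S.bh a)) ^ 2) W) atTop (nhds 0) := by
    rw [← mul_zero (p ^ 2)⁻¹]
    refine Tendsto.const_mul _ ?_
    rw [← Finset.sum_const_zero (s := (Finset.univ : Finset (F2Vec m)))]
    refine tendsto_finsetSum _ fun a _ => ?_
    simp only [treeAvg_comm (σ := minus)]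
    exact tendsto_treeAvg_polarize (fun S => S.bh_nonneg a) (fun S => S.bh_le_one a)
      (fun S => S.bh_plus_le a) (fun S => S.le_bh_minus a) (fun S => S.bh_minus_le a) W
  obtain ⟨n, hn⟩ := (hlim.eventually (gt_mem_nhds hη)).exists
  refine ⟨n, le_trans ?_ hn.le⟩
  rw [← treeAvg_sum, ← treeAvg_const_mul]
  refine treeAvg_mono (fun S => ?_) n W
  have hnn : 0 ≤ ∑ a, (S.bh a * (1 - S.bh a)) ^ 2 := Finset.sum_nonneg fun a _ => sq_nonneg _
  split_ifs with hS
  · positivity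
  · have : ∃ a, p ≤ S.bh a * (1 - S.bh a) := by
      by_contra! hcon
      exact hS (S.exists_submodule_of_polarized hd0 hd1 hd2 hd3 hcon)
    obtain ⟨a, ha⟩ := this
    rw [inv_mul_eq_div, one_le_div (by positivity)]
    exact (pow_le_pow_left₀ hp0.le ha 2).trans
      (Finset.single_le_sum (f := fun a => (S.bh a * (1 - S.bh a)) ^ 2)
        (fun a _ => sq_nonneg _) (Finset.mem_univ a))

/-- The average nullity along the polarization tree converges to the entropy. -/
theorem tendsto_treeAvg_nullity (W : F2Source m) {α : ℝ} (hα : α < 1 / 2) :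
    Tendsto (fun k : ℕ => treeAvg minus plus k
      (fun S : F2Source m => (m : ℝ) - S.maxRk ((2 : ℝ) ^ (-(((2 ^ k : ℕ) : ℝ) ^ α)))) W)
      atTop (nhds (W.ent / Real.log 2)) := by
  have hL : 0 < Real.log 2 := Real.log_pos one_lt_two
  obtain ⟨β, hαβ, hβ⟩ := exists_between (max_lt hα (by norm_num : (0 : ℝ) < 1 / 2))
  have hβ0 : 0 < β := (le_max_right _ _).trans_lt hαβ
  have hαβ' : α < β := (le_max_left _ _).trans_lt hαβ
  rw [Metric.tendsto_atTop']
  intro η hη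
  obtain ⟨δ, hδ, N, hN⟩ := exists_abs_treeAvg_maxRk_sub_ent_le (m := m) hβ0 hβ
    (by positivity : 0 < η / 3)
  obtain ⟨n, hn⟩ := W.exists_treeAvg_not_polarized_le hδ (by positivity : 0 < η / (3 * (m + 1)))
  obtain ⟨l₀, hl₀⟩ := eventually_atTop.1
    (eventually_threshold_le hβ0 hαβ' ((2 ^ 2 ^ m) ^ 2) n)
  refine ⟨n + max N l₀, fun k hk => ?_⟩
  obtain ⟨l, rfl⟩ : ∃ l, k = n + l := ⟨k - n, by omega⟩
  have hl : max N l₀ ≤ l := by omega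
  obtain ⟨c1, c2⟩ := hl₀ l ((le_max_right _ _).trans hl)
  set ε := (2 : ℝ) ^ (-(((2 ^ (n + l) : ℕ) : ℝ) ^ α)) with hε
  have hent : treeAvg minus plus n (fun S : F2Source m => S.ent / Real.log 2) W
      = W.ent / Real.log 2 := by
    refine treeAvg_eq_of_step (fun S => ?_) n W
    rw [← S.ent_step]
    ring
  rw [Real.dist_eq, treeAvg_add_index, ← hent]
  have hdev : ∀ S : F2Source m,
      |treeAvg minus plus l (fun S => (m : ℝ) - S.maxRk ε) S - S.ent / Real.log 2|
        ≤ η / 3 + m * (if ∃ K : Submodule (ZMod 2) (F2Vec m), S.bhOn K ≤ δ ∧ S.foOff K ≤ δ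
          then 0 else 1) := by
    intro S
    split_ifs with hS
    · obtain ⟨K, hb, hf⟩ := hS
      rw [mul_zero, add_zero]
      exact hN S K hb hf l ((le_max_left _ _).trans hl) ε c1 c2
    · have u1 : treeAvg minus plus l (fun S : F2Source m => (m : ℝ) - S.maxRk ε) S ≤ m :=
        (treeAvg_mono (h := fun _ => (m : ℝ)) (fun S => by simp) l S).trans_eq (treeAvg_const _ _ _)
      have u2 : 0 ≤ treeAvg minus plus l (fun S : F2Source m => (m : ℝ) - S.maxRk ε) S :=
        (treeAvg_const 0 l S).symm.trans_le (treeAvg_mono (g := fun _ => (0 : ℝ)) (fun S => by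
          simpa using S.maxRk_le_dim ε) l S)
      have u3 : 0 ≤ S.ent / Real.log 2 := div_nonneg S.ent_nonneg hL.le
      have u4 : S.ent / Real.log 2 ≤ m := (div_le_iff₀ hL).2 S.ent_le
      rw [abs_le]
      constructor <;> linarith
  refine (abs_treeAvg_sub_le hdev n W).trans_lt ?_
  rw [treeAvg_add, treeAvg_const, treeAvg_const_mul]
  have : (m : ℝ) * _ ≤ (m + 1) * (η / (3 * (m + 1))) :=
    mul_le_mul (by linarith) hn ((treeAvg_const 0 n W).symm.trans_le (treeAvg_mono
      (g := fun _ => (0 : ℝ)) (fun S => by split_ifs <;> simp) n W)) (by positivity)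
  have e : ((m : ℝ) + 1) * (η / (3 * (m + 1))) = η / 3 := by field_simp
  linarith

end F2Source

/-! ### The polar transform of a block of independent columns -/

lemma testBit_two_pow_add {k i : ℕ} (hi : i < 2 ^ k) (t : ℕ) :
    (2 ^ k + i).testBit t = (decide (t = k) || i.testBit t) := by
  have h := Nat.two_pow_add_eq_or_of_lt hi 1
  rw [mul_one] at h
  rw [h, Nat.testBit_or, Nat.testBit_two_pow]
  simp [eq_comm]

lemma and_eq_left_iff_testBit {i j : ℕ} :
    j &&& i = j ↔ ∀ t, j.testBit t = true → i.testBit t = true := by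
  constructor
  · intro h t ht
    rw [← h, Nat.testBit_and] at ht
    simp_all
  · intro h
    refine Nat.eq_of_testBit_eq fun t => ?_
    rw [Nat.testBit_and]
    cases hj : j.testBit t
    · simp
    · simp [h t hj]

lemma and_two_pow_add_eq_left_iff {k i j : ℕ} (hi : i < 2 ^ k) (hj : j < 2 ^ k) :
    j &&& (2 ^ k + i) = j ↔ j &&& i = j := by
  simp only [and_eq_left_iff_testBit, testBit_two_pow_add hi]
  refine forall_congr' fun t => ?_
  by_cases ht : t = k
  · subst ht
    simp [Nat.testBit_lt_two_pow hj]
  · simp [ht]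

lemma two_pow_add_and_ne {k i j : ℕ} (hi : i < 2 ^ k) (hj : j < 2 ^ k) :
    (2 ^ k + j) &&& i ≠ 2 ^ k + j := by
  rw [Ne, and_eq_left_iff_testBit]
  intro h
  have := h k (by simp [testBit_two_pow_add hj])
  rw [Nat.testBit_lt_two_pow hi] at this
  simp at this

lemma two_pow_add_and_two_pow_add_iff {k i j : ℕ} (hi : i < 2 ^ k) (hj : j < 2 ^ k) :
    (2 ^ k + j) &&& (2 ^ k + i) = 2 ^ k + j ↔ j &&& i = j := by
  simp only [and_eq_left_iff_testBit, testBit_two_pow_add hi, testBit_two_pow_add hj]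
  refine forall_congr' fun t => ?_
  by_cases ht : t = k
  · subst ht
    simp [Nat.testBit_lt_two_pow hj]
  · simp [ht]

/-- The `j`-th output of the polar transform of a block of columns. -/
def polarCol {m N : ℕ} (x : Fin N → F2Vec m) (j : ℕ) : F2Vec m :=
  ∑ i, if j &&& i.val = j then x i else 0

/-- Joint weight of the `j`-th output `v` and of the previous outputs `y`, for independent columns
with weights `p i`. -/
noncomputable def blockWt {m N : ℕ} (p : Fin N → F2Vec m → ℝ) (j : ℕ) (y : Fin j → F2Vec m)
    (v : F2Vec m) : ℝ :=
  ∑ x : Fin N → F2Vec m,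
    if polarCol x j = v ∧ ∀ i : Fin j, polarCol x i = y i then ∏ i, p i (x i) else 0

section PolarTransform

variable {m k : ℕ}

lemma polarCol_append_of_lt (x x' : Fin (2 ^ k) → F2Vec m) {j : ℕ} (hj : j < 2 ^ k) :
    polarCol (Fin.append x x') j = polarCol (x + x') j := by
  rw [polarCol, polarCol, Fin.sum_univ_add, ← Finset.sum_add_distrib]
  refine Finset.sum_congr rfl fun i _ => ?_
  simp only [Fin.append_left, Fin.append_right, Fin.val_castAdd, Fin.val_natAdd,
    and_two_pow_add_eq_left_iff i.isLt hj, Pi.add_apply]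
  split_ifs <;> simp

lemma polarCol_append_add (x x' : Fin (2 ^ k) → F2Vec m) {j : ℕ} (hj : j < 2 ^ k) :
    polarCol (Fin.append x x') (2 ^ k + j) = polarCol x' j := by
  rw [polarCol, polarCol, Fin.sum_univ_add]
  simp only [Fin.append_left, Fin.append_right, Fin.val_castAdd, Fin.val_natAdd,
    two_pow_add_and_two_pow_add_iff (Fin.isLt _) hj, if_neg (two_pow_add_and_ne (Fin.isLt _) hj),
    Finset.sum_const_zero, zero_add]

lemma polarCol_zero_index {N : ℕ} (hN : N = 1) (x : Fin N → F2Vec m) (i : Fin N) :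
    polarCol x 0 = x i := by
  subst hN
  simp [polarCol, Subsingleton.elim i 0]

lemma polarCol_injective (k : ℕ) :
    Function.Injective fun (x : Fin (2 ^ k) → F2Vec m) (j : Fin (2 ^ k)) => polarCol x j := by
  suffices h : ∀ N, N = 2 ^ k →
      Function.Injective fun (x : Fin N → F2Vec m) (j : Fin N) => polarCol x j from h _ rfl
  induction k with
  | zero =>
    rintro N hN x x' h
    funext i
    have h0 := congrFun h i
    have hi : i.val = 0 := by have := i.isLt; omega
    simp only [hi] at h0
    rwa [polarCol_zero_index hN x i, polarCol_zero_index hN x' i] at h0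
  | succ k ih =>
    rintro N hN x x' h
    obtain rfl : N = 2 ^ k + 2 ^ k := by rw [hN]; ring
    obtain ⟨⟨a, b⟩, rfl⟩ := (Fin.appendEquiv (2 ^ k) (2 ^ k)).surjective x
    obtain ⟨⟨a', b'⟩, rfl⟩ := (Fin.appendEquiv (2 ^ k) (2 ^ k)).surjective x'
    simp only [Fin.appendEquiv, Equiv.coe_fn_mk] at h ⊢
    have hb : b = b' := ih _ rfl (funext fun j => by
      have := congrFun h (Fin.natAdd _ j)
      simpa only [Fin.val_natAdd, polarCol_append_add _ _ j.isLt] using this)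
    have ha : a + b = a' + b' := ih _ rfl (funext fun j => by
      have := congrFun h (Fin.castAdd _ j)
      simpa only [Fin.val_castAdd, polarCol_append_of_lt _ _ j.isLt] using this)
    subst hb
    rw [add_right_cancel ha]

lemma sum_append {A : Type*} [Fintype A] {M N : ℕ} (f : (Fin (M + N) → A) → ℝ) :
    ∑ x, f x = ∑ a : Fin M → A, ∑ b : Fin N → A, f (Fin.append a b) := by
  rw [← (Fin.appendEquiv M N).sum_comp, Fintype.sum_prod_type]
  rfl

lemma sum_append_f2Vec {M : ℕ} (f : (Fin (M + M) → F2Vec m) → ℝ) :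
    ∑ x, f x = ∑ u : Fin M → F2Vec m, ∑ w : Fin M → F2Vec m, f (Fin.append (u + w) w) := by
  rw [sum_append, Finset.sum_comm, Finset.sum_comm (s := Finset.univ) (t := Finset.univ)
    (f := fun (u w : Fin M → F2Vec m) => f (Fin.append (u + w) w))]
  exact Finset.sum_congr rfl fun w _ =>
    (Equiv.sum_comp (Equiv.addRight w) fun a => f (Fin.append a w)).symm

lemma add_add_self_block {M : ℕ} (u w : Fin M → F2Vec m) : u + w + w = u :=
  funext fun i => f2Vec_add_add_cancel (u i) (w i)

lemma blockWt_append_of_lt (p q : Fin (2 ^ k) → F2Vec m → ℝ) {j : ℕ} (hj : j < 2 ^ k)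
    (y : Fin j → F2Vec m) :
    blockWt (Fin.append p q) j y = blockWt (fun i => convWeight (p i) (q i)) j y := by
  funext v
  rw [blockWt, blockWt, sum_append_f2Vec]
  refine Finset.sum_congr rfl fun u _ => ?_
  have hcond : ∀ w, (polarCol (Fin.append (u + w) w) j = v ∧
      ∀ i : Fin j, polarCol (Fin.append (u + w) w) i = y i)
      ↔ (polarCol u j = v ∧ ∀ i : Fin j, polarCol u i = y i) := by
    intro w
    rw [polarCol_append_of_lt _ _ hj, add_add_self_block]
    refine and_congr_right fun _ => forall_congr' fun i => ?_
    rw [polarCol_append_of_lt _ _ (i.isLt.trans hj), add_add_self_block]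
  simp only [hcond]
  split_ifs with h
  · simp only [convWeight, Finset.prod_univ_sum, Fintype.piFinset_univ]
    refine Finset.sum_congr rfl fun w _ => ?_
    rw [Fin.prod_univ_add, ← Finset.prod_mul_distrib]
    simp only [Fin.append_left, Fin.append_right, Pi.add_apply]
  · simp

lemma blockWt_append_add (p q : Fin (2 ^ k) → F2Vec m → ℝ) {j : ℕ} (hj : j < 2 ^ k)
    (u : Fin (2 ^ k) → F2Vec m) (y : Fin j → F2Vec m) :
    blockWt (Fin.append p q) (2 ^ k + j) (Fin.append (fun i : Fin (2 ^ k) => polarCol u i) y)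
      = blockWt (fun i v => p i (u i + v) * q i v) j y := by
  funext v
  rw [blockWt, blockWt, sum_append_f2Vec, Finset.sum_eq_single u]
  · refine Finset.sum_congr rfl fun w _ => ?_
    have hcond : (polarCol (Fin.append (u + w) w) (2 ^ k + j) = v ∧
        ∀ i : Fin (2 ^ k + j), polarCol (Fin.append (u + w) w) i
          = Fin.append (fun i : Fin (2 ^ k) => polarCol u i) y i)
        ↔ (polarCol w j = v ∧ ∀ i : Fin j, polarCol w i = y i) := by
      rw [polarCol_append_add _ _ hj, Fin.forall_fin_add]
      refine and_congr_right fun _ => ?_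
      have h1 : ∀ i : Fin (2 ^ k), polarCol (Fin.append (u + w) w) (Fin.castAdd j i)
          = Fin.append (fun i : Fin (2 ^ k) => polarCol u i) y (Fin.castAdd j i) := by
        intro i
        rw [Fin.append_left, Fin.val_castAdd, polarCol_append_of_lt _ _ i.isLt, add_add_self_block]
      rw [and_iff_right h1]
      refine forall_congr' fun i => ?_
      rw [Fin.append_right, Fin.val_natAdd, polarCol_append_add _ _ (i.isLt.trans hj)]
    simp only [hcond]
    split_ifs with h
    · rw [Fin.prod_univ_add, ← Finset.prod_mul_distrib]
      simp only [Fin.append_left, Fin.append_right, Pi.add_apply]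
    · rfl
  · intro u' _ hu
    refine Finset.sum_eq_zero fun w _ => if_neg fun h => hu (polarCol_injective k ?_)
    funext i
    have := h.2 (Fin.castAdd j i)
    rwa [Fin.append_left, Fin.val_castAdd, polarCol_append_of_lt _ _ i.isLt,
      add_add_self_block] at this
  · simp

end PolarTransform

namespace F2Source

variable {m : ℕ}

/-- The source seen by the `j`-th output of the polar transform of `2 ^ k` copies. -/
noncomputable def path : ℕ → F2Source m → ℕ → F2Source m
  | 0, S, _ => S
  | k + 1, S, j => if j < 2 ^ k then path k S.minus j else path k S.plus (j - 2 ^ k)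

lemma sum_path (g : F2Source m → ℝ) (k : ℕ) (S : F2Source m) :
    ∑ j ∈ Finset.range (2 ^ k), g (path k S j) = 2 ^ k * treeAvg minus plus k g S := by
  induction k generalizing S with
  | zero => simp [path, treeAvg]
  | succ k ih =>
    rw [pow_succ, mul_two, Finset.sum_range_add]
    have h1 : ∑ j ∈ Finset.range (2 ^ k), g (path (k + 1) S j)
        = 2 ^ k * treeAvg minus plus k g S.minus := by
      rw [← ih]
      exact Finset.sum_congr rfl fun j hj => by rw [path, if_pos (Finset.mem_range.1 hj)]
    have h2 : ∑ j ∈ Finset.range (2 ^ k), g (path (k + 1) S (2 ^ k + j))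
        = 2 ^ k * treeAvg minus plus k g S.plus := by
      rw [← ih]
      exact Finset.sum_congr rfl fun j _ => by
        rw [path, if_neg (by omega), Nat.add_sub_cancel_left]
    rw [h1, h2, treeAvg]
    ring

lemma total_path (k : ℕ) (S : F2Source m) (Φ : (F2Vec m → ℝ) → ℝ) {j : ℕ} (hj : j < 2 ^ k) :
    (path k S j).total Φ = ∑ e : Fin (2 ^ k) → S.Idx, ∑ y : Fin j → F2Vec m,
      Φ (blockWt (fun i => S.wt (e i)) j y) := by
  suffices h : ∀ N, N = 2 ^ k → (path k S j).total Φ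
      = ∑ e : Fin N → S.Idx, ∑ y : Fin j → F2Vec m, Φ (blockWt (fun i => S.wt (e i)) j y) from
    h _ rfl
  induction k generalizing S j with
  | zero =>
    rintro N rfl
    obtain rfl : j = 0 := by simpa using hj
    refine Fintype.sum_equiv (Equiv.funUnique (Fin 1) S.Idx).symm _ _ fun e => ?_
    rw [Fintype.sum_unique]
    congr 1
    funext v
    refine Eq.trans ?_ (Equiv.sum_comp (Equiv.funUnique (Fin 1) (F2Vec m)).symm _)
    simp [polarCol, path]
  | succ k ih =>
    rintro N hN
    obtain rfl : N = 2 ^ k + 2 ^ k := by rw [hN]; ring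
    rw [sum_append]
    have happ : ∀ a b : Fin (2 ^ k) → S.Idx, (fun i => S.wt (Fin.append a b i))
        = Fin.append (fun i => S.wt (a i)) fun i => S.wt (b i) := by
      intro a b
      funext i
      refine Fin.addCases (fun i => ?_) (fun i => ?_) i <;>
        simp only [Fin.append_left, Fin.append_right]
    simp only [happ]
    by_cases hjk : j < 2 ^ k
    · rw [path, if_pos hjk, ih S.minus hjk _ rfl]
      refine ((Equiv.arrowProdEquivProdArrow (Fin (2 ^ k)) (fun _ => S.Idx) fun _ => S.Idx).symm.sum_comp
        _).symm.trans ?_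
      rw [Fintype.sum_prod_type]
      refine Finset.sum_congr rfl fun a _ => Finset.sum_congr rfl fun b _ =>
        Finset.sum_congr rfl fun y _ => ?_
      rw [blockWt_append_of_lt _ _ hjk]
      rfl
    · obtain ⟨j', rfl⟩ : ∃ j', j = 2 ^ k + j' := ⟨j - 2 ^ k, by omega⟩
      have hj' : j' < 2 ^ k := by rw [pow_succ] at hj; omega
      rw [path, if_neg hjk, Nat.add_sub_cancel_left, ih S.plus hj' _ rfl]
      refine ((Equiv.arrowProdEquivProdArrow (Fin (2 ^ k)) (fun _ => F2Vec m)
        fun _ => S.Idx × S.Idx).symm.sum_comp _).symm.trans ?_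
      rw [Fintype.sum_prod_type, Finset.sum_comm]
      refine ((Equiv.arrowProdEquivProdArrow (Fin (2 ^ k)) (fun _ => S.Idx)
        fun _ => S.Idx).symm.sum_comp _).symm.trans ?_
      rw [Fintype.sum_prod_type]
      refine Finset.sum_congr rfl fun a _ => Finset.sum_congr rfl fun b _ => ?_
      rw [sum_append]
      have hbij : Function.Bijective
          fun (x : Fin (2 ^ k) → F2Vec m) (i : Fin (2 ^ k)) => polarCol x i :=
        Finite.injective_iff_bijective.1 (polarCol_injective k)
      refine Eq.trans ?_ (Equiv.sum_comp (Equiv.ofBijective _ hbij) fun z => ∑ y, Φ (blockWt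
        (Fin.append (fun i => S.wt (a i)) fun i => S.wt (b i)) (2 ^ k + j') (Fin.append z y)))
      refine Finset.sum_congr rfl fun u _ => Finset.sum_congr rfl fun y _ => ?_
      rw [Equiv.ofBijective_apply, blockWt_append_add _ _ hj']
      rfl

end F2Source

/-! ### Conditional entropies of functions of a finite random variable -/

lemma measureReal_preimage_comp {Ω γ δ : Type*} [MeasurableSpace Ω] {μ : Measure Ω}
    [IsFiniteMeasure μ] [MeasurableSpace γ] [MeasurableSingletonClass γ] [Fintype γ] {Z : Ω → γ}
    (hZ : Measurable Z) (f : γ → δ) (d : δ) :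
    μ.real ((fun ω => f (Z ω)) ⁻¹' {d}) = pushWeight f (fun z => μ.real (Z ⁻¹' {z})) d := by
  rw [pushWeight, sum_measureReal_preimage_singleton _ fun z _ => hZ (measurableSet_singleton z)]
  congr 1
  ext ω
  simp

lemma cEnt_comp_eq {Ω γ δ β : Type*} [MeasurableSpace Ω] {μ : Measure Ω} [IsFiniteMeasure μ]
    [MeasurableSpace γ] [MeasurableSingletonClass γ] [Fintype γ] [Fintype δ] [Fintype β]
    {Z : Ω → γ} (hZ : Measurable Z) (f : γ → δ) (g : γ → β) :
    cEnt μ (fun ω => f (Z ω)) (fun ω => g (Z ω)) = (∑ y, weightEnt fun a =>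
      pushWeight (fun z => (f z, g z)) (fun z => μ.real (Z ⁻¹' {z})) (a, y)) / Real.log 2 := by
  have hsum : ∀ y, ∑ a, pushWeight (fun z => (f z, g z)) (fun z => μ.real (Z ⁻¹' {z})) (a, y)
      = pushWeight g (fun z => μ.real (Z ⁻¹' {z})) y := by
    intro y
    simp only [pushWeight, Prod.mk.injEq, Finset.sum_filter]
    rw [Finset.sum_comm]
    refine Finset.sum_congr rfl fun z _ => ?_
    by_cases h : g z = y <;> simp [h]
  rw [cEnt, shEnt, shEnt, ← sub_div]
  congr 1
  simp only [weightEnt, hsum, Finset.sum_sub_distrib]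
  congr 1
  · rw [Finset.sum_comm, ← Fintype.sum_prod_type' (f := fun a y => Real.negMulLog
      (pushWeight (fun z => (f z, g z)) (fun z => μ.real (Z ⁻¹' {z})) (a, y)))]
    exact Finset.sum_congr rfl fun d _ => congrArg _
      (measureReal_preimage_comp hZ (fun z => (f z, g z)) d)
  · exact Finset.sum_congr rfl fun y _ => congrArg _ (measureReal_preimage_comp hZ g y)

lemma pushWeight_blockWt {m N l : ℕ} (p : Fin N → F2Vec m → ℝ) (j : ℕ) (y : Fin j → F2Vec m)
    (A : Matrix (Fin l) (Fin m) (ZMod 2)) (a : Fin l → ZMod 2) :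
    pushWeight A.mulVec (blockWt p j y) a
      = pushWeight (fun x => (A.mulVec (polarCol x j), fun i : Fin j => polarCol x i))
        (fun x => ∏ i, p i (x i)) (a, y) := by
  simp only [pushWeight, blockWt, Finset.sum_filter, Prod.mk.injEq]
  trans ∑ v, ∑ x : Fin N → F2Vec m, if polarCol x j = v then
    (if A.mulVec (polarCol x j) = a ∧ (fun i : Fin j => polarCol x i) = y
      then ∏ i, p i (x i) else 0) else 0
  · refine Finset.sum_congr rfl fun v _ => ?_
    split_ifs with hv
    · refine Finset.sum_congr rfl fun x _ => ?_
      by_cases hx : polarCol x j = v <;> simp [hx, hv, funext_iff]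
    · refine (Finset.sum_eq_zero fun x _ => ?_).symm
      by_cases hx : polarCol x j = v <;> simp [hx, hv]
  · rw [Finset.sum_comm]
    exact Finset.sum_congr rfl fun x _ => by rw [Finset.sum_ite_eq]; simp

namespace F2Source

/-- The source of law `ν` without side information. -/
noncomputable def ofMeasure {m : ℕ} (ν : Measure (Fin m → ZMod 2)) [IsProbabilityMeasure ν] :
    F2Source m where
  Idx := Unit
  wt _ v := ν.real {v}
  nonneg _ _ := measureReal_nonneg
  sum_eq_one := by
    rw [Fintype.sum_unique, sum_measureReal_singleton]
    simp

variable {m : ℕ} (ν : Measure (Fin m → ZMod 2)) [IsProbabilityMeasure ν]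

noncomputable instance : Unique (ofMeasure ν).Idx := inferInstanceAs (Unique Unit)

lemma ent_ofMeasure : (ofMeasure ν).ent / Real.log 2 = distEnt ν := by
  have h : ∑ v, ν.real {v} = 1 := by rw [sum_measureReal_singleton]; simp
  have h' : (ofMeasure ν).ent = weightEnt fun v => ν.real {v} := by
    rw [F2Source.ent, total, Fintype.sum_unique]
    rfl
  rw [h', weightEnt, h, distEnt, Real.negMulLog_one, sub_zero]
  rfl

lemma linEnt_path_ofMeasure {k l j : ℕ} (hj : j < 2 ^ k) (A : Matrix (Fin l) (Fin m) (ZMod 2)) :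
    (path k (ofMeasure ν) j).linEnt A = ∑ y : Fin j → F2Vec m, weightEnt fun a =>
      pushWeight (fun x : Fin (2 ^ k) → F2Vec m =>
        (A.mulVec (polarCol x j), fun i : Fin j => polarCol x i))
        (fun x => ∏ i, ν.real {x i}) (a, y) := by
  rw [linEnt, total_path k _ _ hj]
  rw [Fintype.sum_unique]
  refine Finset.sum_congr rfl fun y _ => congrArg _ (funext fun a => ?_)
  exact pushWeight_blockWt _ _ _ _ _

end F2Source

lemma mul_G_apply {m k : ℕ} (M : Fin m → Fin (2 ^ k) → ZMod 2) (r : Fin m) (j : Fin (2 ^ k)) :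
    (Matrix.of M * G k) r j = polarCol (fun i s => M s i) j r := by
  rw [Matrix.mul_apply, polarCol, Finset.sum_apply]
  refine Finset.sum_congr rfl fun i _ => ?_
  simp only [G, Matrix.of_apply]
  split_ifs <;> simp

lemma maxRank_mul_G_eq {m k : ℕ} (ν : Measure (Fin m → ZMod 2)) [IsProbabilityMeasure ν]
    {Ω : Type*} [MeasurableSpace Ω] {μ : Measure Ω} [IsProbabilityMeasure μ]
    {X : Ω → Fin m → Fin (2 ^ k) → ZMod 2} (hmeas : Measurable X)
    (hiid : μ.map (fun ω => fun j i => X ω i j) = Measure.pi fun _ : Fin (2 ^ k) => ν)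
    (ε : ℝ) (j : Fin (2 ^ k)) :
    maxRank μ (fun ω (i : Fin m) => (Matrix.of (X ω) * G k) i j)
      (fun ω (j' : Fin j.val) (r : Fin m) => (Matrix.of (X ω) * G k) r (j'.castLE j.isLt.le)) ε
      = (F2Source.path k (F2Source.ofMeasure ν) j).maxRk ε := by
  have hZ : Measurable (fun ω => fun (j : Fin (2 ^ k)) (i : Fin m) => X ω i j) := by fun_prop
  have hlaw : ∀ x, μ.real ((fun ω => fun (j : Fin (2 ^ k)) (i : Fin m) => X ω i j) ⁻¹' {x})
      = ∏ i, ν.real {x i} := by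
    intro x
    rw [← map_measureReal_apply hZ (measurableSet_singleton x), hiid, Measure.real,
      Measure.pi_singleton, ENNReal.toReal_prod]
    rfl
  simp only [maxRank, F2Source.maxRk, mul_G_apply, Fin.val_castLE]
  congr 1
  ext r
  refine exists_congr fun l => exists_congr fun A => and_congr_right fun _ => ?_
  have h := cEnt_comp_eq (μ := μ) hZ (fun x => A.mulVec (polarCol x j))
    (fun x (i : Fin j.val) => polarCol x i)
  simp only [hlaw] at h
  rw [F2Source.linEnt_path_ofMeasure ν j.isLt, ← h]

/-- total nullity with exponentially small thresholds `ε_n = 2^{-n^α}`,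
`α < 1/2`. -/
theorem statement4 (m : ℕ) (hm : 1 ≤ m)
    (ν : Measure (Fin m → ZMod 2)) [IsProbabilityMeasure ν]
    (Ω : ℕ → Type) [∀ k, MeasurableSpace (Ω k)] (μ : ∀ k, Measure (Ω k))
    (hprob : ∀ k, IsProbabilityMeasure (μ k))
    (X : ∀ k, Ω k → Fin m → Fin (2 ^ k) → ZMod 2)
    (hmeas : ∀ k, Measurable (X k))
    (hiid : ∀ k, (μ k).map (fun ω => fun j i => X k ω i j)
      = Measure.pi fun _ : Fin (2 ^ k) => ν)
    (α : ℝ) (hα : α < 1 / 2) :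
    Tendsto (fun k : ℕ =>
        (∑ j : Fin (2 ^ k),
          ((m : ℝ) - maxRank (μ k) (fun ω (i : Fin m) => (Matrix.of (X k ω) * G k) i j)
            (fun ω (j' : Fin j.val) (r : Fin m) =>
              (Matrix.of (X k ω) * G k) r (j'.castLE j.isLt.le))
            ((2 : ℝ) ^ (-(((2 ^ k : ℕ) : ℝ) ^ α))))) / 2 ^ k)
      atTop (nhds (distEnt ν)) := by
  have := hprob
  refine (F2Source.ent_ofMeasure ν ▸
    F2Source.tendsto_treeAvg_nullity (F2Source.ofMeasure ν) hα).congr fun k => ?_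
  simp only [maxRank_mul_G_eq ν (hmeas k) (hiid k)]
  rw [Fin.sum_univ_eq_sum_range (fun j => (m : ℝ) - (F2Source.path k (F2Source.ofMeasure ν)
    j).maxRk ((2 : ℝ) ^ (-(((2 ^ k : ℕ) : ℝ) ^ α)))), F2Source.sum_path (fun S => (m : ℝ) - S.maxRk
    ((2 : ℝ) ^ (-(((2 ^ k : ℕ) : ℝ) ^ α)))), mul_div_cancel_left₀ _ (by positivity)]
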